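/- arXiv:1105.3968 — 5 statements merged into one kernel-verified Lean document; each statement's English description precedes it below -/
import Mathlib

section
/- The ℤ[1/2]-algebra homomorphism ℤ[1/2][X,Y,Z] → Λ sending X ↦ c₄, Y ↦ c₆, Z ↦ Δ has image exactly the invariant subring Λ^{S₃}, and its kernel is the principal ideal generated by X³ − Y² − 1728·Z. Hence Λ^{S₃} ≅ ℤ[1/2][X,Y,Z]/(X³ − Y² − 1728Z), the ring of modular forms with 2 inverted. -/
open MvPolynomial

set_option synthInstance.maxHeartbeats 1000000
set_option maxHeartbeats 4000000

noncomputable section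

/-- The ring ℤ[1/2], realized as the subring of ℚ generated by 1/2. -/
abbrev R2 : Type := Subring.closure {(2⁻¹ : ℚ)}

/-- Λ = ℤ[1/2][λ₁, λ₂], with λ₁ = X 0 and λ₂ = X 1. -/
abbrev Lam : Type := MvPolynomial (Fin 2) R2

/-- A chosen 3-cycle σ₀ in S₃ = Perm (Fin 3). -/
def sig0 : Equiv.Perm (Fin 3) := finRotate 3

/-- A chosen transposition τ₀ in S₃ = Perm (Fin 3); note `tau0 * sig0 * tau0 = sig0 ^ 2`. -/
def tau0 : Equiv.Perm (Fin 3) := Equiv.swap 1 2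

/-- c₄ = 16(λ₁² − λ₁λ₂ + λ₂²). -/
def cFour : Lam := 16 * (X 0 ^ 2 - X 0 * X 1 + X 1 ^ 2)

/-- c₆ = 32(λ₁ + λ₂)(2λ₁² − 5λ₁λ₂ + 2λ₂²). -/
def cSix : Lam := 32 * (X 0 + X 1) * (2 * X 0 ^ 2 - 5 * X 0 * X 1 + 2 * X 1 ^ 2)

/-- Δ = 16λ₁²λ₂²(λ₁ − λ₂)². -/
def Del : Lam := 16 * X 0 ^ 2 * X 1 ^ 2 * (X 0 - X 1) ^ 2

/-- d = λ₁λ₂(λ₁ − λ₂). -/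
def dE : Lam := X 0 * X 1 * (X 0 - X 1)

/-- The subalgebra Λ^{S₃} of invariants for an action ρ of S₃ on Λ by
ℤ[1/2]-algebra automorphisms. -/
def invS (ρ : Equiv.Perm (Fin 3) →* (Lam ≃ₐ[R2] Lam)) : Subalgebra R2 Lam where
  carrier := {f | ∀ g, ρ g f = f}
  mul_mem' := fun hf hg g => by rw [map_mul, hf g, hg g]
  add_mem' := fun hf hg g => by rw [map_add, hf g, hg g]
  algebraMap_mem' := fun r g => by rw [AlgEquiv.commutes]

end

noncomputable section

theorem exists_two_mul_eq_one : ∃ h : R2, 2 * h = 1 :=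
  ⟨⟨2⁻¹, Subring.subset_closure rfl⟩, Subtype.ext (mul_inv_cancel₀ (two_ne_zero' ℚ))⟩

/-- Restriction of a polynomial in `λ₁, λ₂` to the line through `(u, v)`. -/
def lineEval (u v : R2) : Lam →ₐ[R2] Polynomial R2 :=
  aeval ![Polynomial.C u * Polynomial.X, Polynomial.C v * Polynomial.X]

@[simp]
theorem lineEval_X_zero (u v : R2) : lineEval u v (X 0) = Polynomial.C u * Polynomial.X := by
  simp [lineEval]

@[simp]
theorem lineEval_X_one (u v : R2) : lineEval u v (X 1) = Polynomial.C v * Polynomial.X := by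
  simp [lineEval]

theorem coeff_zero_lineEval (u v : R2) (f : Lam) :
    (lineEval u v f).coeff 0 = constantCoeff f := by
  induction f using MvPolynomial.induction_on with
  | C a => simp [lineEval]
  | add p q hp hq => simp [hp, hq]
  | mul_X p i hp =>
    fin_cases i <;> simp [Polynomial.mul_coeff_zero]

theorem coeff_one_lineEval (u v : R2) (f : Lam) :
    (lineEval u v f).coeff 1 =
      u * (lineEval 1 0 f).coeff 1 + v * (lineEval 0 1 f).coeff 1 := by
  induction f using MvPolynomial.induction_on with
  | C a => simp [lineEval]
  | add p q hp hq => simp only [map_add, Polynomial.coeff_add, hp, hq]; ring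
  | mul_X p i hp =>
    fin_cases i <;>
    · simp only [Fin.zero_eta, Fin.mk_one, map_mul, lineEval_X_zero, lineEval_X_one, ← mul_assoc,
        Polynomial.coeff_mul_X, Polynomial.coeff_mul_C, coeff_zero_lineEval]
      ring

theorem natDegree_lineEval_le (u v : R2) (f : Lam) :
    (lineEval u v f).natDegree ≤ f.totalDegree := by
  have h := MvPolynomial.aeval_natDegree_le (m := f.totalDegree) (n := 1) f le_rfl
    ![Polynomial.C u * Polynomial.X, Polynomial.C v * Polynomial.X]
    (fun i => by fin_cases i <;> simpa using (Polynomial.natDegree_C_mul_X_pow_le _ 1))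
  simpa [lineEval] using h

theorem X_one_dvd_sub_lineEval (f : Lam) :
    (X 1 : Lam) ∣ f - Polynomial.aeval (X 0 : Lam) (lineEval 1 0 f) := by
  induction f using MvPolynomial.induction_on with
  | C a => simp [lineEval, MvPolynomial.algebraMap_eq]
  | add p q hp hq =>
    rw [map_add, map_add, add_sub_add_comm]
    exact dvd_add hp hq
  | mul_X p i hp =>
    fin_cases i
    · simpa [← sub_mul] using hp.mul_right (X 0)
    · simp

theorem X_one_dvd_of_lineEval_eq_zero {f : Lam} (h : lineEval 1 0 f = 0) : (X 1 : Lam) ∣ f := by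
  simpa [h] using X_one_dvd_sub_lineEval f

theorem dE_ne_zero : dE ≠ 0 := by
  intro h
  have := congrArg (aeval ![(1 : R2), -1]) h
  simp [dE] at this

theorem one_le_totalDegree_dE : 1 ≤ dE.totalDegree := by
  have h := dE_ne_zero
  rw [dE] at h ⊢
  rw [totalDegree_mul_of_isDomain (left_ne_zero_of_mul h) (right_ne_zero_of_mul h),
    totalDegree_mul_of_isDomain (X_ne_zero 0) (X_ne_zero 1), totalDegree_X]
  omega

section Invariants

variable {σ τ : Lam ≃ₐ[R2] Lam}

theorem map_dE_of_rotation (h₀ : σ (X 0) = X 1 - X 0) (h₁ : σ (X 1) = -X 0) : σ dE = dE := by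
  simp only [dE, map_mul, map_sub, h₀, h₁]; ring

theorem map_dE_of_swap (h₀ : τ (X 0) = X 1) (h₁ : τ (X 1) = X 0) : τ dE = -dE := by
  simp only [dE, map_mul, map_sub, h₀, h₁]; ring

theorem dE_dvd_of_lineEval_eq_zero (h₀ : σ (X 0) = X 1 - X 0) (h₁ : σ (X 1) = -X 0) {f : Lam}
    (hf : σ f = f) (h : lineEval 1 0 f = 0) : dE ∣ f := by
  have d₁ := X_one_dvd_of_lineEval_eq_zero h
  have d₀ : (X 0 : Lam) ∣ f := by
    have := map_dvd σ d₁
    rw [h₁, hf] at this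
    obtain ⟨g, hg⟩ := this
    exact ⟨-g, by linear_combination hg⟩
  have d₂ : (X 0 - X 1 : Lam) ∣ f := by
    have := map_dvd σ d₀
    rwa [h₀, hf, ← neg_dvd, neg_sub] at this
  have p₀ : Prime (X 0 : Lam) := X_prime
  have p₂ : Prime (X 0 - X 1 : Lam) := by
    have := (MulEquiv.prime_iff σ.toMulEquiv).2 p₀
    simpa [h₀] using this.neg
  have n₀ : ¬ (X 0 : Lam) ∣ X 1 := by
    intro hd
    simpa using map_dvd (aeval ![(0 : R2), 1]) hd
  have n₂ : ∀ i : Fin 2, ¬ (X 0 - X 1 : Lam) ∣ X i := by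
    intro i hd
    fin_cases i <;> simpa using map_dvd (aeval ![(1 : R2), 1]) hd
  obtain ⟨g, rfl⟩ := d₁
  obtain ⟨h, rfl⟩ := (p₀.dvd_or_dvd d₀).resolve_left n₀
  obtain ⟨k, rfl⟩ := (p₂.dvd_or_dvd ((p₂.dvd_or_dvd d₂).resolve_left (n₂ 1))).resolve_left (n₂ 0)
  exact ⟨k, by rw [dE]; ring⟩

theorem lineEval_swap (h₀ : τ (X 0) = X 1) (h₁ : τ (X 1) = X 0) (f : Lam) :
    lineEval 1 0 (τ f) = lineEval 0 1 f := by
  have : (lineEval 1 0).comp τ.toAlgHom = lineEval 0 1 := by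
    ext i : 1
    fin_cases i <;> simp [h₀, h₁]
  exact DFunLike.congr_fun this f

theorem lineEval_rotation (h₀ : σ (X 0) = X 1 - X 0) (h₁ : σ (X 1) = -X 0) (f : Lam) :
    lineEval 1 0 (σ f) = lineEval (-1) (-1) f := by
  have : (lineEval 1 0).comp σ.toAlgHom = lineEval (-1) (-1) := by
    ext i : 1
    fin_cases i <;> simp [h₀, h₁] <;> ring
  exact DFunLike.congr_fun this f

theorem lineEval_swap_rotation (hσ₀ : σ (X 0) = X 1 - X 0) (hσ₁ : σ (X 1) = -X 0)
    (hτ₀ : τ (X 0) = X 1) (hτ₁ : τ (X 1) = X 0) (f : Lam) :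
    lineEval 1 0 (τ (σ f)) = lineEval 1 0 f := by
  have : (lineEval 1 0).comp (τ.toAlgHom.comp σ.toAlgHom) = lineEval 1 0 := by
    ext i : 1
    fin_cases i <;> simp [hσ₀, hσ₁, hτ₀, hτ₁]
  exact DFunLike.congr_fun this f

theorem coeff_one_lineEval_eq_zero (hσ₀ : σ (X 0) = X 1 - X 0) (hσ₁ : σ (X 1) = -X 0)
    (hτ₀ : τ (X 0) = X 1) (hτ₁ : τ (X 1) = X 0) {f : Lam} (hσ : σ f = f) (hτ : τ f = f) :
    (lineEval 1 0 f).coeff 1 = 0 := by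
  have e₁ := lineEval_swap hτ₀ hτ₁ f
  have e₂ := lineEval_rotation hσ₀ hσ₁ f
  rw [hτ] at e₁
  rw [hσ] at e₂
  have h := coeff_one_lineEval (-1) (-1) f
  rw [← e₁, ← e₂] at h
  have h3 : (3 : R2) * (lineEval 1 0 f).coeff 1 = 0 := by linear_combination h
  exact (mul_eq_zero.1 h3).resolve_left (by norm_num)

theorem exists_eq_dE_sq_mul (hσ₀ : σ (X 0) = X 1 - X 0) (hσ₁ : σ (X 1) = -X 0)
    (hτ₀ : τ (X 0) = X 1) (hτ₁ : τ (X 1) = X 0) {f : Lam} (hσ : σ f = f) (hτ : τ f = f)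
    (h : lineEval 1 0 f = 0) : ∃ g, f = dE ^ 2 * g ∧ σ g = g ∧ τ g = g := by
  have cancel : ∀ {a b : Lam}, dE * a = dE * b → a = b := mul_left_cancel₀ dE_ne_zero
  have sd := map_dE_of_rotation hσ₀ hσ₁
  have td := map_dE_of_swap hτ₀ hτ₁
  obtain ⟨g, rfl⟩ := dE_dvd_of_lineEval_eq_zero hσ₀ hσ₁ hσ h
  rw [map_mul, sd] at hσ
  rw [map_mul, td] at hτ
  have sg : σ g = g := cancel hσ
  have tg : τ g = -g := cancel (by linear_combination -hτ)
  have hg : lineEval 1 0 g = 0 := by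
    have e := lineEval_swap_rotation hσ₀ hσ₁ hτ₀ hτ₁ g
    rw [sg, tg, map_neg] at e
    exact self_eq_neg.1 e.symm
  obtain ⟨k, rfl⟩ := dE_dvd_of_lineEval_eq_zero hσ₀ hσ₁ sg hg
  rw [map_mul, sd] at sg
  rw [map_mul, td] at tg
  exact ⟨k, by ring, cancel sg, cancel (by linear_combination -tg)⟩

end Invariants

/-- The homomorphism `ℤ[1/2][X, Y, Z] → Λ` given by `c₄, c₆, Δ`. -/
abbrev modularMap : MvPolynomial (Fin 3) R2 →ₐ[R2] Lam := aeval ![cFour, cSix, Del]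

theorem map_mem_range_modularMap {φ : Lam ≃ₐ[R2] Lam} (h₄ : φ cFour = cFour)
    (h₆ : φ cSix = cSix) (hΔ : φ Del = Del) {f : Lam} (hf : f ∈ modularMap.range) : φ f = f := by
  obtain ⟨F, rfl⟩ := hf
  have : φ.toAlgHom.comp modularMap = modularMap := by
    ext i : 1
    fin_cases i <;> simp [h₄, h₆, hΔ]
  exact DFunLike.congr_fun this F

theorem cFour_mem_range : cFour ∈ modularMap.range := ⟨X 0, by simp⟩

theorem cSix_mem_range : cSix ∈ modularMap.range := ⟨X 1, by simp⟩

theorem Del_mem_range : Del ∈ modularMap.range := ⟨X 2, by simp⟩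

theorem dE_sq_mem_range : dE ^ 2 ∈ modularMap.range := by
  obtain ⟨h, hh⟩ := exists_two_mul_eq_one
  have hC : (2 : Lam) * C h = 1 := by rw [← map_ofNat C 2, ← map_mul, hh, map_one]
  have : dE ^ 2 = h ^ 4 • Del := by
    rw [smul_eq_C_mul, map_pow, dE, Del]
    have h4 : (16 : Lam) * C h ^ 4 = 1 := by linear_combination congrArg (· ^ 4) hC
    linear_combination (-(X 0 ^ 2 * X 1 ^ 2 * (X 0 - X 1) ^ 2)) * h4
  rw [this]
  exact Subalgebra.smul_mem _ Del_mem_range _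

/-- The modular forms with 2 inverted realise every power of `λ₁` except the first on the line
`λ₂ = 0`. -/
theorem exists_mem_range_lineEval_eq_X_pow {k : ℕ} (hk : k ≠ 1) :
    ∃ q ∈ modularMap.range, lineEval 1 0 q = Polynomial.X ^ k ∧ q.totalDegree ≤ k := by
  obtain ⟨h, hh⟩ := exists_two_mul_eq_one
  have hP : (2 : Polynomial R2) * Polynomial.C h = 1 := by
    rw [← map_ofNat Polynomial.C 2, ← map_mul, hh, map_one]
  have hX : ∀ i, (X i : Lam).IsHomogeneous 1 := isHomogeneous_X R2
  have hn : ∀ n : ℕ, [n.AtLeastTwo] → (OfNat.ofNat n : Lam).IsHomogeneous 0 := fun n _ => by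
    rw [← map_ofNat C n]
    exact isHomogeneous_C _ _
  have d₄ : cFour.totalDegree ≤ 2 := by
    have : cFour.IsHomogeneous 2 :=
      (hn 16).mul ((((hX 0).pow 2).sub ((hX 0).mul (hX 1))).add ((hX 1).pow 2))
    exact this.totalDegree_le
  have d₆ : cSix.totalDegree ≤ 3 := by
    have : cSix.IsHomogeneous 3 :=
      ((hn 32).mul ((hX 0).add (hX 1))).mul
        ((((hn 2).mul ((hX 0).pow 2)).sub (((hn 5).mul (hX 0)).mul (hX 1))).add
          ((hn 2).mul ((hX 1).pow 2)))
    exact this.totalDegree_le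
  have e₄ : lineEval 1 0 (h ^ 4 • cFour) = Polynomial.X ^ 2 := by
    simp only [cFour, map_smul, Polynomial.smul_eq_C_mul, map_pow, map_mul, map_add, map_sub,
      map_ofNat, lineEval_X_zero, lineEval_X_one, map_one, map_zero]
    linear_combination Polynomial.X ^ 2 * congrArg (· ^ 4) hP
  have e₆ : lineEval 1 0 (h ^ 6 • cSix) = Polynomial.X ^ 3 := by
    simp only [cSix, map_smul, Polynomial.smul_eq_C_mul, map_pow, map_mul, map_add, map_sub,
      map_ofNat, lineEval_X_zero, lineEval_X_one, map_one, map_zero]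
    linear_combination Polynomial.X ^ 3 * congrArg (· ^ 6) hP
  obtain ⟨i, j, rfl⟩ : ∃ i j, k = i * 2 + j * 3 := by
    rcases Nat.even_or_odd' k with ⟨m, rfl | rfl⟩
    · exact ⟨m, 0, by omega⟩
    · exact ⟨m - 1, 1, by omega⟩
  refine ⟨(h ^ 4 • cFour) ^ i * (h ^ 6 • cSix) ^ j,
    mul_mem (pow_mem (Subalgebra.smul_mem _ cFour_mem_range _) _)
      (pow_mem (Subalgebra.smul_mem _ cSix_mem_range _) _), ?_, ?_⟩
  · rw [map_mul, map_pow, map_pow, e₄, e₆]; ring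
  · refine (totalDegree_mul _ _).trans (add_le_add ?_ ?_)
    · exact (totalDegree_pow _ _).trans
        (Nat.mul_le_mul_left _ ((totalDegree_smul_le _ _).trans d₄))
    · exact (totalDegree_pow _ _).trans
        (Nat.mul_le_mul_left _ ((totalDegree_smul_le _ _).trans d₆))

theorem exists_mem_range_lineEval_eq {P : Polynomial R2} (h : P.coeff 1 = 0) :
    ∃ q ∈ modularMap.range, lineEval 1 0 q = P ∧ q.totalDegree ≤ P.natDegree := by
  have hq : ∀ k, ∃ q ∈ modularMap.range,
      lineEval 1 0 q = Polynomial.C (P.coeff k) * Polynomial.X ^ k ∧ q.totalDegree ≤ k := by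
    intro k
    by_cases hk : k = 1
    · subst hk
      exact ⟨0, zero_mem _, by simp [h], by simp⟩
    · obtain ⟨q, hm, he, hd⟩ := exists_mem_range_lineEval_eq_X_pow hk
      exact ⟨P.coeff k • q, Subalgebra.smul_mem _ hm _,
        by rw [map_smul, he, Polynomial.smul_eq_C_mul], (totalDegree_smul_le _ _).trans hd⟩
  choose q hm he hd using hq
  refine ⟨∑ k ∈ Finset.range (P.natDegree + 1), q k, sum_mem fun k _ => hm k, ?_, ?_⟩
  · rw [map_sum, Finset.sum_congr rfl fun k _ => he k, ← Polynomial.as_sum_range_C_mul_X_pow]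
  · exact totalDegree_finsetSum_le fun k hk => (hd k).trans (by simpa [Nat.lt_succ_iff] using hk)

theorem mem_range_modularMap_of_invariant {σ τ : Lam ≃ₐ[R2] Lam}
    (hσ₀ : σ (X 0) = X 1 - X 0) (hσ₁ : σ (X 1) = -X 0)
    (hτ₀ : τ (X 0) = X 1) (hτ₁ : τ (X 1) = X 0)
    (hσ : ∀ f ∈ modularMap.range, σ f = f) (hτ : ∀ f ∈ modularMap.range, τ f = f)
    {f : Lam} (hfσ : σ f = f) (hfτ : τ f = f) : f ∈ modularMap.range := by
  induction hn : f.totalDegree using Nat.strong_induction_on generalizing f with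
  | _ n ih =>
  obtain ⟨q, hm, he, hd⟩ :=
    exists_mem_range_lineEval_eq (coeff_one_lineEval_eq_zero hσ₀ hσ₁ hτ₀ hτ₁ hfσ hfτ)
  obtain ⟨g, hg, hgσ, hgτ⟩ := exists_eq_dE_sq_mul hσ₀ hσ₁ hτ₀ hτ₁ (f := f - q)
    (by rw [map_sub, hfσ, hσ q hm]) (by rw [map_sub, hfτ, hτ q hm]) (by rw [map_sub, he, sub_self])
  suffices g ∈ modularMap.range by
    rw [← sub_add_cancel f q, hg]
    exact add_mem (mul_mem dE_sq_mem_range this) hm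
  by_cases h0 : g = 0
  · rw [h0]; exact zero_mem _
  refine ih _ ?_ hgσ hgτ rfl
  have hdeg : (dE ^ 2 * g).totalDegree ≤ n := by
    rw [← hg, ← hn]
    exact (totalDegree_sub _ _).trans
      (max_le le_rfl (hd.trans (natDegree_lineEval_le _ _ _)))
  rw [pow_two, mul_assoc, totalDegree_mul_of_isDomain dE_ne_zero (mul_ne_zero dE_ne_zero h0),
    totalDegree_mul_of_isDomain dE_ne_zero h0] at hdeg
  have := one_le_totalDegree_dE
  omega

theorem invariant_of_mem_range_of_rotation {σ : Lam ≃ₐ[R2] Lam}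
    (h₀ : σ (X 0) = X 1 - X 0) (h₁ : σ (X 1) = -X 0) {f : Lam} (hf : f ∈ modularMap.range) :
    σ f = f := by
  refine map_mem_range_modularMap ?_ ?_ ?_ hf <;>
  · simp only [cFour, cSix, Del, map_mul, map_add, map_sub, map_pow, map_ofNat, h₀, h₁]
    ring

theorem invariant_of_mem_range_of_swap {τ : Lam ≃ₐ[R2] Lam}
    (h₀ : τ (X 0) = X 1) (h₁ : τ (X 1) = X 0) {f : Lam} (hf : f ∈ modularMap.range) :
    τ f = f := by
  refine map_mem_range_modularMap ?_ ?_ ?_ hf <;>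
  · simp only [cFour, cSix, Del, map_mul, map_add, map_sub, map_pow, map_ofNat, h₀, h₁]
    ring

theorem exists_eq_sig0_pow_mul_tau0_pow (g : Equiv.Perm (Fin 3)) :
    ∃ i : Fin 3, ∃ j : Fin 2, g = sig0 ^ (i : ℕ) * tau0 ^ (j : ℕ) := by
  revert g
  unfold sig0 tau0
  decide

theorem range_modularMap_eq_invS {ρ : Equiv.Perm (Fin 3) →* (Lam ≃ₐ[R2] Lam)}
    (hσ₁ : ρ sig0 (X 0) = X 1 - X 0) (hσ₂ : ρ sig0 (X 1) = - X 0)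
    (hτ₁ : ρ tau0 (X 0) = X 1) (hτ₂ : ρ tau0 (X 1) = X 0) :
    modularMap.range = invS ρ := by
  have hσ : ∀ f ∈ modularMap.range, ρ sig0 f = f := fun f =>
    invariant_of_mem_range_of_rotation hσ₁ hσ₂
  have hτ : ∀ f ∈ modularMap.range, ρ tau0 f = f := fun f =>
    invariant_of_mem_range_of_swap hτ₁ hτ₂
  refine le_antisymm (fun f hf g => ?_) fun f hf =>
    mem_range_modularMap_of_invariant hσ₁ hσ₂ hτ₁ hτ₂ hσ hτ (hf sig0) (hf tau0)
  obtain ⟨i, j, rfl⟩ := exists_eq_sig0_pow_mul_tau0_pow g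
  have pow_fix : ∀ (φ : Lam ≃ₐ[R2] Lam) (n : ℕ), φ f = f → (φ ^ n) f = f := by
    intro φ n h
    induction n with
    | zero => rfl
    | succ n ih => rw [pow_succ, AlgEquiv.mul_apply, h, ih]
  rw [map_mul, map_pow, map_pow, AlgEquiv.mul_apply, pow_fix _ _ (hτ f hf),
    pow_fix _ _ (hσ f hf)]

/-- The homomorphism `ℤ[1/2][X][Z] → A` sending `X` to `a` and `Z` to `b`. -/
abbrev evalPair {A : Type*} [CommRing A] [Algebra R2 A] (a b : A) :
    Polynomial (Polynomial R2) →+* A :=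
  Polynomial.eval₂RingHom (Polynomial.aeval (R := R2) a).toRingHom b

theorem map_evalPair {A B : Type*} [CommRing A] [Algebra R2 A] [CommRing B] [Algebra R2 B]
    (φ : A →ₐ[R2] B) (a b : A) (P : Polynomial (Polynomial R2)) :
    φ (evalPair a b P) = evalPair (φ a) (φ b) P := by
  have : φ.toRingHom.comp (evalPair a b) = evalPair (φ a) (φ b) := by
    ext <;> simp
  exact DFunLike.congr_fun this P

theorem Del_ne_zero : Del ≠ 0 := by
  have : Del = 16 * dE ^ 2 := by rw [Del, dE]; ring
  rw [this]
  exact mul_ne_zero (by norm_num) (pow_ne_zero 2 dE_ne_zero)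

theorem cSix_ne_zero : cSix ≠ 0 := by
  intro h
  have := congrArg (aeval ![(1 : R2), 0]) h
  simp [cSix] at this

theorem aeval_cFour_eq_zero {P : Polynomial R2} {g : Lam}
    (h : g * Del + Polynomial.aeval cFour P = 0) : P = 0 := by
  have h' := congrArg (lineEval 1 0) h
  have h₄ : lineEval 1 0 cFour = 16 * Polynomial.X ^ 2 := by
    simp [cFour, map_ofNat (lineEval 1 0) 16]
  have hΔ : lineEval 1 0 Del = 0 := by simp [Del]
  rw [map_add, map_mul, hΔ, mul_zero, zero_add, ← Polynomial.aeval_algHom_apply, h₄,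
    map_zero, ← Polynomial.comp_eq_aeval, Polynomial.comp_eq_zero_iff] at h'
  refine h'.resolve_right fun hc => ?_
  have := congrArg (Polynomial.coeff · 2) hc.2
  simp at this

theorem evalPair_cFour_Del_injective : Function.Injective (evalPair cFour Del) := by
  rw [injective_iff_map_eq_zero]
  intro P
  induction hn : P.natDegree using Nat.strong_induction_on generalizing P with
  | _ n ih =>
  intro hP
  have e : evalPair cFour Del P =
      evalPair cFour Del P.divX * Del + Polynomial.aeval cFour (P.coeff 0) := by
    conv_lhs => rw [← Polynomial.divX_mul_X_add P]
    simp
  have h0 : P.coeff 0 = 0 := aeval_cFour_eq_zero (e ▸ hP)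
  rw [hP, h0, map_zero, add_zero, eq_comm, mul_eq_zero, or_iff_left Del_ne_zero] at e
  have hX := Polynomial.divX_mul_X_add P
  rw [h0, map_zero, add_zero] at hX
  by_cases hd : P.natDegree = 0
  · rw [Polynomial.eq_C_of_natDegree_eq_zero hd, h0, map_zero]
  · rw [← hX, ih P.divX.natDegree
      (by rw [← hn, Polynomial.natDegree_divX_eq_natDegree_tsub_one]; omega) _ rfl e,
      zero_mul]

/-- The ideal generated by `X³ - Y² - 1728 Z`. -/
abbrev relIdeal : Ideal (MvPolynomial (Fin 3) R2) :=
  Ideal.span {(X 0 ^ 3 - X 1 ^ 2 - 1728 * X 2 : MvPolynomial (Fin 3) R2)}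

theorem exists_sub_mem_relIdeal (F : MvPolynomial (Fin 3) R2) :
    ∃ A B, F - (evalPair (X 0) (X 2) A + X 1 * evalPair (X 0) (X 2) B) ∈ relIdeal := by
  simp only [relIdeal, Ideal.mem_span_singleton']
  induction F using MvPolynomial.induction_on with
  | C a => exact ⟨Polynomial.C (Polynomial.C a), 0, 0, by simp [MvPolynomial.algebraMap_eq]⟩
  | add F G hF hG =>
    obtain ⟨A, B, c, h⟩ := hF
    obtain ⟨A', B', c', h'⟩ := hG
    refine ⟨A + A', B + B', c + c', ?_⟩
    rw [map_add, map_add]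
    linear_combination h + h'
  | mul_X F i hF =>
    obtain ⟨A, B, c, h⟩ := hF
    have eX : evalPair (X 0 : MvPolynomial (Fin 3) R2) (X 2) (Polynomial.C Polynomial.X) = X 0 := by
      simp
    have eZ : evalPair (X 0 : MvPolynomial (Fin 3) R2) (X 2) Polynomial.X = X 2 := by simp
    fin_cases i
    · refine ⟨Polynomial.C Polynomial.X * A, Polynomial.C Polynomial.X * B, c * X 0, ?_⟩
      simp only [map_mul, eX, Fin.zero_eta]
      linear_combination X 0 * h
    · refine ⟨(Polynomial.C Polynomial.X ^ 3 - 1728 * Polynomial.X) * B, A,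
        c * X 1 - evalPair (X 0) (X 2) B, ?_⟩
      have eR : evalPair (X 0 : MvPolynomial (Fin 3) R2) (X 2)
          (Polynomial.C Polynomial.X ^ 3 - 1728 * Polynomial.X) = X 0 ^ 3 - 1728 * X 2 :=
        (map_sub (evalPair (X 0 : MvPolynomial (Fin 3) R2) (X 2)) _ _).trans
          (by rw [map_pow, map_mul, map_ofNat, eX, eZ])
      simp only [map_mul, eR, Fin.mk_one]
      linear_combination X 1 * h
    · refine ⟨Polynomial.X * A, Polynomial.X * B, c * X 2, ?_⟩
      simp only [map_mul, eZ, Fin.reduceFinMk]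
      linear_combination X 2 * h

theorem evalPair_eq_zero_of_add_cSix_mul_eq_zero {A B : Polynomial (Polynomial R2)}
    (h : evalPair cFour Del A + cSix * evalPair cFour Del B = 0) : A = 0 ∧ B = 0 := by
  let ν : Lam →ₐ[R2] Lam := aeval ![-X 0, -X 1]
  have ν₀ : ν (X 0) = -X 0 := by simp [ν]
  have ν₁ : ν (X 1) = -X 1 := by simp [ν]
  have h₄ : ν cFour = cFour := by
    simp only [cFour, map_mul, map_add, map_sub, map_pow, map_ofNat, ν₀, ν₁]; ring
  have h₆ : ν cSix = -cSix := by
    simp only [cSix, map_mul, map_add, map_sub, map_pow, map_ofNat, ν₀, ν₁]; ring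
  have hΔ : ν Del = Del := by
    simp only [Del, map_mul, map_sub, map_pow, map_ofNat, ν₀, ν₁]; ring
  have h' := congrArg ν h
  rw [map_add, map_mul, map_evalPair, map_evalPair, h₄, h₆, hΔ, map_zero] at h'
  have hA : 2 * evalPair cFour Del A = 0 := by linear_combination h + h'
  have hA := (mul_eq_zero.1 hA).resolve_left two_ne_zero
  rw [hA, zero_add] at h
  have hB := (mul_eq_zero.1 h).resolve_left cSix_ne_zero
  exact ⟨evalPair_cFour_Del_injective (by rw [hA, map_zero]),
    evalPair_cFour_Del_injective (by rw [hB, map_zero])⟩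

theorem ker_modularMap : RingHom.ker modularMap = relIdeal := by
  have m₀ : modularMap (X 0) = cFour := by simp
  have m₁ : modularMap (X 1) = cSix := by simp
  have m₂ : modularMap (X 2) = Del := by simp
  have hle : relIdeal ≤ RingHom.ker modularMap := by
    rw [Ideal.span_singleton_le_iff_mem, RingHom.mem_ker]
    simp only [map_mul, map_sub, map_pow, map_ofNat, m₀, m₁, m₂, cFour, cSix, Del]
    ring
  refine le_antisymm (fun F hF => ?_) hle
  obtain ⟨A, B, h⟩ := exists_sub_mem_relIdeal F
  have h' := hle h
  rw [RingHom.mem_ker] at hF h'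
  rw [map_sub, hF, zero_sub, neg_eq_zero, map_add, map_mul, map_evalPair, map_evalPair,
    m₀, m₁, m₂] at h'
  obtain ⟨rfl, rfl⟩ := evalPair_eq_zero_of_add_cSix_mul_eq_zero h'
  simpa using h

end

/-!
STATEMENT 3: The ℤ[1/2]-algebra map ℤ[1/2][X,Y,Z] → Λ, X ↦ c₄, Y ↦ c₆, Z ↦ Δ, has
image exactly Λ^{S₃} and kernel the principal ideal (X³ − Y² − 1728·Z). Hence
Λ^{S₃} ≅ ℤ[1/2][X,Y,Z]/(X³ − Y² − 1728Z).
-/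

theorem statement3 (ρ : Equiv.Perm (Fin 3) →* (Lam ≃ₐ[R2] Lam))
    (hσ₁ : ρ sig0 (X 0) = X 1 - X 0) (hσ₂ : ρ sig0 (X 1) = - X 0)
    (hτ₁ : ρ tau0 (X 0) = X 1) (hτ₂ : ρ tau0 (X 1) = X 0) :
    (MvPolynomial.aeval ![cFour, cSix, Del] :
        MvPolynomial (Fin 3) R2 →ₐ[R2] Lam).range = invS ρ ∧
    RingHom.ker (MvPolynomial.aeval ![cFour, cSix, Del] :
        MvPolynomial (Fin 3) R2 →ₐ[R2] Lam) =
      Ideal.span {(X 0 ^ 3 - X 1 ^ 2 - 1728 * X 2 : MvPolynomial (Fin 3) R2)} ∧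
    Nonempty ((MvPolynomial (Fin 3) R2 ⧸
        Ideal.span {(X 0 ^ 3 - X 1 ^ 2 - 1728 * X 2 : MvPolynomial (Fin 3) R2)})
      ≃ₐ[R2] invS ρ) := by
  have hrange := range_modularMap_eq_invS hσ₁ hσ₂ hτ₁ hτ₂
  refine ⟨hrange, ker_modularMap, ⟨?_⟩⟩
  exact ((Ideal.quotientEquivAlgOfEq R2 ker_modularMap.symm).trans
    (Ideal.quotientKerEquivRange modularMap)).trans (Subalgebra.equivOfEq _ _ hrange)
end

section
/- Let C₃ act on A = ℤ[1/2][x₀,x₁,x₂] by cyclically permuting the variables (x₀ ↦ x₁ ↦ x₂ ↦ x₀). Then the invariant subring A^{C₃} is generated as a ℤ[1/2]-algebra by the elementary symmetric polynomials e₁ = x₀+x₁+x₂, e₂ = x₀x₁+x₁x₂+x₂x₀, e₃ = x₀x₁x₂ together with ε = (x₀−x₁)(x₁−x₂)(x₂−x₀); and the kernel of the ℤ[1/2]-algebra map ℤ[1/2][S₁,S₂,S₃,E] → A^{C₃} sending S₁ ↦ e₁, S₂ ↦ e₂, S₃ ↦ e₃, E ↦ ε is the principal ideal generated by E² − (S₁²S₂²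 − 4S₂³ − 4S₁³S₃ + 18S₁S₂S₃ − 27S₃²). -/
open MvPolynomial

set_option synthInstance.maxHeartbeats 1000000
set_option maxHeartbeats 4000000

/-!
STATEMENT 7: For the C₃-action on A = ℤ[1/2][x₀,x₁,x₂] cyclically permuting the
variables, the invariant subring A^{C₃} is generated as a ℤ[1/2]-algebra by
e₁, e₂, e₃, ε = (x₀−x₁)(x₁−x₂)(x₂−x₀), and the kernel of
ℤ[1/2][S₁,S₂,S₃,E] → A^{C₃}, S₁ ↦ e₁, S₂ ↦ e₂, S₃ ↦ e₃, E ↦ ε, is the principal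
ideal (E² − (S₁²S₂² − 4S₂³ − 4S₁³S₃ + 18S₁S₂S₃ − 27S₃²)).
-/

/-- A = ℤ[1/2][x₀, x₁, x₂]. -/
abbrev AP : Type := MvPolynomial (Fin 3) R2

/-- e₁ = x₀ + x₁ + x₂. -/
noncomputable def e₁ : AP := X 0 + X 1 + X 2
/-- e₂ = x₀x₁ + x₁x₂ + x₂x₀. -/
noncomputable def e₂ : AP := X 0 * X 1 + X 1 * X 2 + X 2 * X 0
/-- e₃ = x₀x₁x₂. -/
noncomputable def e₃ : AP := X 0 * X 1 * X 2
/-- ε = (x₀−x₁)(x₁−x₂)(x₂−x₀). -/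
noncomputable def eps : AP := (X 0 - X 1) * (X 1 - X 2) * (X 2 - X 0)

/-- A polynomial killed by the substitution `X j ↦ X i` is divisible by `X i - X j`. -/
theorem X_sub_X_dvd_of_aeval_update_eq_zero {σ R : Type*} [DecidableEq σ] [CommRing R] (i j : σ)
    {p : MvPolynomial σ R}
    (hp : aeval (Function.update (X : σ → MvPolynomial σ R) j (X i)) p = 0) :
    X i - X j ∣ p := by
  rw [← Ideal.mem_span_singleton, ← Ideal.Quotient.eq_zero_iff_mem]
  have h : ((Ideal.Quotient.mkₐ R (Ideal.span {(X i - X j : MvPolynomial σ R)})).comp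
      (aeval (Function.update (X : σ → MvPolynomial σ R) j (X i)))) =
      Ideal.Quotient.mkₐ R (Ideal.span {(X i - X j : MvPolynomial σ R)}) := by
    refine MvPolynomial.algHom_ext fun k => ?_
    rcases eq_or_ne k j with rfl | hk
    · simp only [AlgHom.comp_apply, aeval_X, Function.update_self, Ideal.Quotient.mkₐ_eq_mk]
      exact Ideal.Quotient.eq.2 (Ideal.mem_span_singleton_self _)
    · simp [hk]
  have h' := DFunLike.congr_fun h p
  rw [AlgHom.comp_apply, hp, map_zero] at h'
  exact h'.symm

/-- A polynomial that changes sign under the transposition of `i` and `j` vanishes on the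
diagonal `X i = X j`. -/
theorem aeval_update_eq_zero_of_rename_swap {σ R : Type*} [DecidableEq σ] [CommRing R]
    [IsDomain R] (h2 : (2 : MvPolynomial σ R) ≠ 0) (i j : σ) {p : MvPolynomial σ R}
    (hp : rename (Equiv.swap i j) p = -p) :
    aeval (Function.update (X : σ → MvPolynomial σ R) j (X i)) p = 0 := by
  have h : (aeval (Function.update (X : σ → MvPolynomial σ R) j (X i)))
      (rename (Equiv.swap i j) p) =
      aeval (Function.update (X : σ → MvPolynomial σ R) j (X i)) p := by
    rw [aeval_rename]
    congr 2
    funext k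
    by_cases hki : k = i <;> by_cases hkj : k = j <;>
      simp_all [Function.update_apply, Equiv.swap_apply_def]
  rw [hp, map_neg] at h
  have : 2 * aeval (Function.update (X : σ → MvPolynomial σ R) j (X i)) p = 0 := by
    linear_combination -h
  exact (mul_eq_zero.1 this).resolve_left h2

/-- An alternating polynomial in three variables is divisible by the Vandermonde product. -/
theorem vandermonde_dvd_of_alternating {R : Type*} [CommRing R] [IsDomain R]
    (h2 : (2 : MvPolynomial (Fin 3) R) ≠ 0) {p : MvPolynomial (Fin 3) R}
    (h01 : rename (Equiv.swap 0 1) p = -p) (h12 : rename (Equiv.swap 1 2) p = -p)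
    (h20 : rename (Equiv.swap 2 0) p = -p) :
    (X 0 - X 1) * (X 1 - X 2) * (X 2 - X 0) ∣ p := by
  have hX : ∀ i j : Fin 3, i ≠ j → (X i - X j : MvPolynomial (Fin 3) R) ≠ 0 :=
    fun i j hij h => hij (X_injective (sub_eq_zero.1 h))
  obtain ⟨q, rfl⟩ := X_sub_X_dvd_of_aeval_update_eq_zero 0 1
    (aeval_update_eq_zero_of_rename_swap h2 0 1 h01)
  have hq := aeval_update_eq_zero_of_rename_swap h2 1 2 h12
  rw [map_mul] at hq
  obtain ⟨r, rfl⟩ := X_sub_X_dvd_of_aeval_update_eq_zero 1 2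
    ((mul_eq_zero.1 hq).resolve_left (by simpa using hX 0 1 (by decide)))
  have hr := aeval_update_eq_zero_of_rename_swap h2 2 0 h20
  rw [map_mul, map_mul] at hr
  obtain ⟨s, rfl⟩ := X_sub_X_dvd_of_aeval_update_eq_zero 2 0
    ((mul_eq_zero.1 ((mul_eq_zero.1 hr).resolve_left
      (by simpa using hX 2 1 (by decide)))).resolve_left (by simpa using hX 1 2 (by decide)))
  exact ⟨s, by ring⟩

/-- Invariance under a transposition and a 3-cycle implies symmetry. -/
theorem isSymmetric_of_swap_of_finRotate {R : Type*} [CommRing R] {p : MvPolynomial (Fin 3) R}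
    (hs : rename (Equiv.swap (0 : Fin 3) 1) p = p) (hr : rename (finRotate 3) p = p) :
    p.IsSymmetric := by
  have hmul : ∀ e f : Equiv.Perm (Fin 3), rename e p = p → rename f p = p →
      rename (e * f) p = p := fun e f he hf => by
    rw [Equiv.Perm.coe_mul, ← rename_rename, hf, he]
  intro e
  have : ∀ e : Equiv.Perm (Fin 3), e = finRotate 3 * finRotate 3 * finRotate 3 ∨
      e = finRotate 3 ∨ e = finRotate 3 * finRotate 3 ∨ e = Equiv.swap 0 1 ∨
      e = finRotate 3 * Equiv.swap 0 1 ∨ e = finRotate 3 * finRotate 3 * Equiv.swap 0 1 := by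
    decide
  rcases this e with rfl | rfl | rfl | rfl | rfl | rfl
  · exact hmul _ _ (hmul _ _ hr hr) hr
  · exact hr
  · exact hmul _ _ hr hr
  · exact hs
  · exact hmul _ _ hr hs
  · exact hmul _ _ (hmul _ _ hr hr) hs

theorem exists_C_mul_two_eq_one : ∃ u : R2, (C u : AP) * 2 = 1 := by
  refine ⟨⟨2⁻¹, Subring.subset_closure rfl⟩, ?_⟩
  have h : (⟨2⁻¹, Subring.subset_closure rfl⟩ : R2) * 2 = 1 := by
    apply Subtype.ext
    change (2⁻¹ : ℚ) * 2 = 1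
    norm_num
  have h2 : (2 : AP) = C 2 := (map_ofNat C 2).symm
  rw [h2, ← C_mul, h, C_1]

theorem two_ne_zero_AP : (2 : AP) ≠ 0 := fun h => by
  obtain ⟨u, hu⟩ := exists_C_mul_two_eq_one
  simp [h] at hu

theorem eps_ne_zero : eps ≠ 0 := by
  have hX : ∀ i j : Fin 3, i ≠ j → (X i - X j : AP) ≠ 0 :=
    fun i j hij h => hij (X_injective (sub_eq_zero.1 h))
  exact mul_ne_zero (mul_ne_zero (hX _ _ (by decide)) (hX _ _ (by decide))) (hX _ _ (by decide))

theorem rename_swap_eps : rename (Equiv.swap (0 : Fin 3) 1) eps = -eps := by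
  have h2 : Equiv.swap (0 : Fin 3) 1 2 = 2 := by decide
  simp only [eps, map_mul, map_sub, rename_X, Equiv.swap_apply_left, Equiv.swap_apply_right, h2]
  ring

theorem rename_finRotate_eps : rename (finRotate 3) eps = eps := by
  have h0 : finRotate 3 0 = 1 := by decide
  have h1 : finRotate 3 1 = 2 := by decide
  have h2 : finRotate 3 2 = 0 := by decide
  simp only [eps, map_mul, map_sub, rename_X, h0, h1, h2]
  ring

theorem esymmAlgHom_eq_aeval (p : MvPolynomial (Fin 3) R2) :
    (esymmAlgHom (Fin 3) R2 3 p : AP) = aeval ![e₁, e₂, e₃] p := by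
  rw [esymmAlgHom_apply]
  congr 2
  have p1 : Finset.powersetCard 1 (Finset.univ : Finset (Fin 3)) = {{0}, {1}, {2}} := by decide
  have p2 : Finset.powersetCard 2 (Finset.univ : Finset (Fin 3)) = {{0, 1}, {1, 2}, {2, 0}} := by
    decide
  have p3 : Finset.powersetCard 3 (Finset.univ : Finset (Fin 3)) = {{0, 1, 2}} := by decide
  funext i
  fin_cases i
  · change esymm (Fin 3) R2 1 = e₁
    rw [esymm, p1, Finset.sum_insert (by decide), Finset.sum_insert (by decide)]
    simp [e₁, add_assoc]
  · change esymm (Fin 3) R2 2 = e₂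
    rw [esymm, p2, Finset.sum_insert (by decide), Finset.sum_insert (by decide),
      Finset.sum_singleton, Finset.prod_pair (by decide), Finset.prod_pair (by decide),
      Finset.prod_pair (by decide)]
    simp [e₂, add_assoc]
  · change esymm (Fin 3) R2 3 = e₃
    rw [esymm, p3, Finset.sum_singleton, Finset.prod_insert (by decide),
      Finset.prod_pair (by decide)]
    simp [e₃, mul_assoc]

theorem isSymmetric_aeval_elementary (p : MvPolynomial (Fin 3) R2) :
    (aeval ![e₁, e₂, e₃] p : AP).IsSymmetric := by
  rw [← esymmAlgHom_eq_aeval]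
  exact (esymmAlgHom (Fin 3) R2 3 p).2

theorem exists_aeval_elementary_eq {f : AP} (hf : f.IsSymmetric) :
    ∃ p : MvPolynomial (Fin 3) R2, aeval ![e₁, e₂, e₃] p = f := by
  obtain ⟨p, hp⟩ := esymmAlgHom_surjective R2 (σ := Fin 3) (n := 3) (by simp) ⟨f, hf⟩
  exact ⟨p, by rw [← esymmAlgHom_eq_aeval, hp]⟩

theorem aeval_elementary_injective :
    Function.Injective (aeval ![e₁, e₂, e₃] : MvPolynomial (Fin 3) R2 →ₐ[R2] AP) := by
  intro p q h
  rw [← esymmAlgHom_eq_aeval, ← esymmAlgHom_eq_aeval] at h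
  exact esymmAlgHom_injective R2 (σ := Fin 3) (n := 3) (by simp) (Subtype.ext h)

/-- A cyclically invariant polynomial is `a + b * eps` with `a` and `b` symmetric. -/
theorem exists_eq_add_mul_eps {f : AP} (hf : rename (finRotate 3) f = f) :
    ∃ a b : MvPolynomial (Fin 3) R2,
      f = aeval ![e₁, e₂, e₃] a + aeval ![e₁, e₂, e₃] b * eps := by
  obtain ⟨u, hu⟩ := exists_C_mul_two_eq_one
  set t := rename (R := R2) (Equiv.swap (0 : Fin 3) 1) with ht
  have comp : ∀ (e e' : Equiv.Perm (Fin 3)) (q : AP),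
      rename e (rename e' q) = rename (e * e') q := fun e e' q => by
    rw [rename_rename, Equiv.Perm.coe_mul]
  have htt : t (t f) = f := by
    rw [ht, comp, Equiv.swap_mul_self, Equiv.Perm.coe_one, rename_id_apply]
  have hff : rename (finRotate 3 * finRotate 3) f = f := by rw [← comp, hf, hf]
  have hrt : rename (finRotate 3) (t f) = t f := by
    rw [ht, comp, show finRotate 3 * Equiv.swap 0 1 =
      Equiv.swap 0 1 * (finRotate 3 * finRotate 3) by decide, ← comp, hff]
  have hadd : (f + t f).IsSymmetric :=
    isSymmetric_of_swap_of_finRotate (by rw [map_add, ← ht, htt, add_comm])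
      (by rw [map_add, hf, hrt])
  have h01 : rename (Equiv.swap (0 : Fin 3) 1) (f - t f) = -(f - t f) := by
    rw [map_sub, ← ht, htt, neg_sub]
  have hr : rename (finRotate 3) (f - t f) = f - t f := by rw [map_sub, hf, hrt]
  have h12 : rename (Equiv.swap (1 : Fin 3) 2) (f - t f) = -(f - t f) := by
    rw [show Equiv.swap (1 : Fin 3) 2 = finRotate 3 * (finRotate 3 * Equiv.swap 0 1) by decide,
      ← comp, ← comp, h01, map_neg, map_neg, hr, hr]
  have h20 : rename (Equiv.swap (2 : Fin 3) 0) (f - t f) = -(f - t f) := by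
    rw [show Equiv.swap (2 : Fin 3) 0 = finRotate 3 * Equiv.swap 0 1 by decide,
      ← comp, h01, map_neg, hr]
  obtain ⟨h, hh⟩ : eps ∣ f - t f := vandermonde_dvd_of_alternating two_ne_zero_AP h01 h12 h20
  have hsymm : h.IsSymmetric := by
    refine isSymmetric_of_swap_of_finRotate ?_ ?_ <;> apply mul_left_cancel₀ eps_ne_zero
    · rw [hh, map_mul, rename_swap_eps] at h01
      linear_combination -h01
    · rwa [hh, map_mul, rename_finRotate_eps] at hr
  obtain ⟨a, ha⟩ := exists_aeval_elementary_eq hadd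
  obtain ⟨b, hb⟩ := exists_aeval_elementary_eq hsymm
  refine ⟨C u * a, C u * b, ?_⟩
  rw [map_mul, map_mul, ha, hb, aeval_C, algebraMap_eq]
  linear_combination (-f) * hu + C u * hh

theorem eq_zero_of_add_mul_eps_eq_zero {a b : MvPolynomial (Fin 3) R2}
    (h : aeval ![e₁, e₂, e₃] a + aeval ![e₁, e₂, e₃] b * eps = 0) : a = 0 ∧ b = 0 := by
  have h' := congrArg (rename (Equiv.swap (0 : Fin 3) 1)) h
  rw [map_add, map_mul, isSymmetric_aeval_elementary a, isSymmetric_aeval_elementary b,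
    rename_swap_eps, map_zero] at h'
  have ha : (aeval ![e₁, e₂, e₃] a : AP) = 0 :=
    (mul_eq_zero.1 (show (2 : AP) * aeval ![e₁, e₂, e₃] a = 0 by
      linear_combination h + h')).resolve_left two_ne_zero_AP
  have hb : (aeval ![e₁, e₂, e₃] b : AP) = 0 :=
    (mul_eq_zero.1 (show (aeval ![e₁, e₂, e₃] b : AP) * eps = 0 by
      linear_combination h - ha)).resolve_right eps_ne_zero
  exact ⟨aeval_elementary_injective (by rw [ha, map_zero]),
    aeval_elementary_injective (by rw [hb, map_zero])⟩

/-- Division by a polynomial `X 3 ^ 2 - d` with `d` free of `X 3`: every polynomial is congruent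
to one that is linear in the last variable. -/
theorem exists_sub_linear_mem_span {R : Type*} [CommRing R] (d : MvPolynomial (Fin 3) R)
    (p : MvPolynomial (Fin 4) R) :
    ∃ a b : MvPolynomial (Fin 3) R,
      p - (rename Fin.castSucc a + rename Fin.castSucc b * X (Fin.last 3)) ∈
        Ideal.span {X (Fin.last 3) ^ 2 - rename Fin.castSucc d} := by
  simp only [Ideal.mem_span_singleton]
  induction p using MvPolynomial.induction_on with
  | C r => exact ⟨C r, 0, by simp⟩
  | add p q hp hq =>
    obtain ⟨a, b, k, hk⟩ := hp
    obtain ⟨a', b', k', hk'⟩ := hq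
    refine ⟨a + a', b + b', k + k', ?_⟩
    rw [map_add, map_add]
    linear_combination hk + hk'
  | mul_X p i hp =>
    obtain ⟨a, b, k, hk⟩ := hp
    induction i using Fin.lastCases with
    | last =>
      refine ⟨b * d, a, k * X (Fin.last 3) + rename Fin.castSucc b, ?_⟩
      rw [map_mul]
      linear_combination X (Fin.last 3) * hk
    | cast i =>
      refine ⟨a * X i, b * X i, k * X i.castSucc, ?_⟩
      rw [map_mul, map_mul, rename_X]
      linear_combination X i.castSucc * hk

theorem aeval_rename_castSucc (a : MvPolynomial (Fin 3) R2) :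
    (aeval ![e₁, e₂, e₃, eps] (rename Fin.castSucc a) : AP) = aeval ![e₁, e₂, e₃] a := by
  rw [aeval_rename]
  congr 2
  funext i
  fin_cases i <;> rfl

theorem eps_sq : eps ^ 2 = e₁ ^ 2 * e₂ ^ 2 - 4 * e₂ ^ 3 - 4 * e₁ ^ 3 * e₃
    + 18 * e₁ * e₂ * e₃ - 27 * e₃ ^ 2 := by
  simp only [eps, e₁, e₂, e₃]
  ring

theorem statement7 (c : AP ≃ₐ[R2] AP)
    (hc₀ : c (X 0) = X 1) (hc₁ : c (X 1) = X 2) (hc₂ : c (X 2) = X 0) :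
    {f : AP | c f = f} = (Algebra.adjoin R2 {e₁, e₂, e₃, eps} : Subalgebra R2 AP) ∧
    RingHom.ker (MvPolynomial.aeval ![e₁, e₂, e₃, eps] :
        MvPolynomial (Fin 4) R2 →ₐ[R2] AP) =
      Ideal.span {(X 3 ^ 2 - (X 0 ^ 2 * X 1 ^ 2 - 4 * X 1 ^ 3 - 4 * X 0 ^ 3 * X 2
        + 18 * X 0 * X 1 * X 2 - 27 * X 2 ^ 2) : MvPolynomial (Fin 4) R2)} := by
  constructor
  · have hc : ∀ f, c f = rename (finRotate 3) f := by
      have h : (c : AP →ₐ[R2] AP) = rename (finRotate 3) := by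
        refine MvPolynomial.algHom_ext fun i => ?_
        rw [rename_X]
        fin_cases i
        · exact hc₀
        · exact hc₁
        · exact hc₂
      exact fun f => DFunLike.congr_fun h f
    have hrange : ∀ i, ![e₁, e₂, e₃] i ∈ Algebra.adjoin R2 {e₁, e₂, e₃, eps} := by
      intro i
      apply Algebra.subset_adjoin
      fin_cases i <;> simp
    have hmem : ∀ a : MvPolynomial (Fin 3) R2,
        (aeval ![e₁, e₂, e₃] a : AP) ∈ Algebra.adjoin R2 {e₁, e₂, e₃, eps} := by
      intro a
      have ha : (aeval ![e₁, e₂, e₃] a : AP) ∈ (aeval (R := R2) ![e₁, e₂, e₃]).range := ⟨a, rfl⟩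
      rw [← Algebra.adjoin_range_eq_range_aeval] at ha
      exact Algebra.adjoin_le (Set.range_subset_iff.2 hrange) ha
    apply Set.Subset.antisymm
    · intro f hf
      obtain ⟨a, b, rfl⟩ := exists_eq_add_mul_eps ((hc f).symm.trans hf)
      exact add_mem (hmem a) (mul_mem (hmem b) (Algebra.subset_adjoin (by simp)))
    · have hle : Algebra.adjoin R2 {e₁, e₂, e₃, eps} ≤
          AlgHom.equalizer (c : AP →ₐ[R2] AP) (AlgHom.id R2 AP) := by
        refine Algebra.adjoin_le ?_
        rintro _ (rfl | rfl | rfl | rfl) <;>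
          rw [SetLike.mem_coe, AlgHom.mem_equalizer, AlgHom.id_apply, AlgEquiv.coe_toAlgHom]
        · simp only [e₁, map_add, hc₀, hc₁, hc₂]
          ring
        · simp only [e₂, map_add, map_mul, hc₀, hc₁, hc₂]
          ring
        · simp only [e₃, map_mul, hc₀, hc₁, hc₂]
          ring
        · simp only [eps, map_sub, map_mul, hc₀, hc₁, hc₂]
          ring
      exact fun f hf => hle hf
  · have hle : Ideal.span {(X 3 ^ 2 - (X 0 ^ 2 * X 1 ^ 2 - 4 * X 1 ^ 3 - 4 * X 0 ^ 3 * X 2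
        + 18 * X 0 * X 1 * X 2 - 27 * X 2 ^ 2) : MvPolynomial (Fin 4) R2)} ≤
        RingHom.ker (MvPolynomial.aeval ![e₁, e₂, e₃, eps] :
          MvPolynomial (Fin 4) R2 →ₐ[R2] AP) := by
      rw [Ideal.span_singleton_le_iff_mem, RingHom.mem_ker]
      simp only [map_sub, map_add, map_mul, map_pow, map_ofNat, aeval_X]
      exact sub_eq_zero.2 eps_sq
    apply le_antisymm
    · intro p hp
      obtain ⟨a, b, hab⟩ := exists_sub_linear_mem_span (X 0 ^ 2 * X 1 ^ 2 - 4 * X 1 ^ 3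
        - 4 * X 0 ^ 3 * X 2 + 18 * X 0 * X 1 * X 2 - 27 * X 2 ^ 2) p
      simp only [map_sub, map_add, map_mul, map_pow, map_ofNat, rename_X] at hab
      have hlin := hle hab
      rw [RingHom.mem_ker] at hp hlin
      rw [map_sub, hp, zero_sub, neg_eq_zero, map_add, map_mul, aeval_rename_castSucc,
        aeval_rename_castSucc, aeval_X] at hlin
      obtain ⟨rfl, rfl⟩ := eq_zero_of_add_mul_eps_eq_zero hlin
      rw [map_zero, zero_mul, add_zero, sub_zero] at hab
      exact hab
    · exact hle
end

section
/- The image of the norm map N : Λ → Λ, N(f) = Σ_{g ∈ S₃} g·f (whose values lie in Λ^{S₃}), is exactly the ideal of the ring Λ^{S₃} generated by 3, c₄, and c₆. -/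
open MvPolynomial

set_option synthInstance.maxHeartbeats 1000000
set_option maxHeartbeats 4000000

/-- The sum of the translates of `f` under an action of S₃ on Λ. -/
noncomputable def orbitSum (ρ : Equiv.Perm (Fin 3) →* (Lam ≃ₐ[R2] Lam)) : Lam →ₗ[R2] Lam :=
  ∑ g : Equiv.Perm (Fin 3), (ρ g).toLinearMap

/-- The ideal of Λ^{S₃} generated by 3, c₄ and c₆, as an R2-submodule of Λ. -/
def normIdeal (ρ : Equiv.Perm (Fin 3) →* (Lam ≃ₐ[R2] Lam)) : Submodule R2 Lam where
  carrier := {y | ∃ u ∈ invS ρ, ∃ v ∈ invS ρ, ∃ w ∈ invS ρ,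
    y = 3 * u + cFour * v + cSix * w}
  zero_mem' := ⟨0, zero_mem _, 0, zero_mem _, 0, zero_mem _, by simp⟩
  add_mem' := by
    rintro _ _ ⟨u, hu, v, hv, w, hw, rfl⟩ ⟨u', hu', v', hv', w', hw', rfl⟩
    exact ⟨u + u', add_mem hu hu', v + v', add_mem hv hv', w + w', add_mem hw hw', by ring⟩
  smul_mem' := by
    rintro r _ ⟨u, hu, v, hv, w, hw, rfl⟩
    refine ⟨r • u, Subalgebra.smul_mem _ hu r, r • v, Subalgebra.smul_mem _ hv r,
      r • w, Subalgebra.smul_mem _ hw r, ?_⟩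
    simp only [smul_add, mul_smul_comm]

section

variable {ρ : Equiv.Perm (Fin 3) →* (Lam ≃ₐ[R2] Lam)}

lemma orbitSum_apply (f : Lam) : orbitSum ρ f = ∑ g : Equiv.Perm (Fin 3), ρ g f := by
  simp [orbitSum]

lemma orbitSum_mem_invS (f : Lam) : orbitSum ρ f ∈ invS ρ := by
  intro h
  rw [orbitSum_apply, map_sum]
  simp only [← AlgEquiv.mul_apply, ← map_mul]
  exact Equiv.sum_comp (Equiv.mulLeft h) fun g => ρ g f

lemma orbitSum_mul {a : Lam} (ha : a ∈ invS ρ) (f : Lam) :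
    orbitSum ρ (a * f) = a * orbitSum ρ f := by
  simp only [orbitSum_apply, map_mul, Finset.mul_sum]
  exact Finset.sum_congr rfl fun g _ => by rw [ha g]

lemma orbitSum_eq (f : Lam) : orbitSum ρ f =
    f + ρ sig0 f + ρ sig0 (ρ sig0 f)
      + (ρ tau0 f + ρ tau0 (ρ sig0 f) + ρ tau0 (ρ sig0 (ρ sig0 f))) := by
  have huniv : (Finset.univ : Finset (Equiv.Perm (Fin 3))) =
      {1, sig0, sig0 * sig0, tau0, tau0 * sig0, tau0 * (sig0 * sig0)} := by
    unfold sig0 tau0; decide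
  rw [orbitSum_apply, huniv]
  repeat rw [Finset.sum_insert (by unfold sig0 tau0; decide)]
  simp only [Finset.sum_singleton, map_mul, map_one, AlgEquiv.mul_apply, AlgEquiv.one_apply]
  ring

lemma mem_invS_of_generators {f : Lam} (hs : ρ sig0 f = f) (ht : ρ tau0 f = f) :
    f ∈ invS ρ := by
  have h : ∀ g : Equiv.Perm (Fin 3), g = 1 ∨ g = sig0 ∨ g = sig0 * sig0 ∨ g = tau0 ∨
      g = tau0 * sig0 ∨ g = tau0 * (sig0 * sig0) := by
    unfold sig0 tau0; decide
  intro g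
  rcases h g with rfl | rfl | rfl | rfl | rfl | rfl <;> simp [hs, ht]

lemma mul_mem_normIdeal {a y : Lam} (ha : a ∈ invS ρ) (hy : y ∈ normIdeal ρ) :
    a * y ∈ normIdeal ρ := by
  obtain ⟨u, hu, v, hv, w, hw, rfl⟩ := hy
  exact ⟨a * u, mul_mem ha hu, a * v, mul_mem ha hv, a * w, mul_mem ha hw, by ring⟩

lemma three_mul_mem_normIdeal {u : Lam} (hu : u ∈ invS ρ) : 3 * u ∈ normIdeal ρ :=
  ⟨u, hu, 0, zero_mem _, 0, zero_mem _, by ring⟩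

lemma cFour_mul_mem_normIdeal {v : Lam} (hv : v ∈ invS ρ) : cFour * v ∈ normIdeal ρ :=
  ⟨0, zero_mem _, v, hv, 0, zero_mem _, by ring⟩

lemma cSix_mul_mem_normIdeal {w : Lam} (hw : w ∈ invS ρ) : cSix * w ∈ normIdeal ρ :=
  ⟨0, zero_mem _, 0, zero_mem _, w, hw, by ring⟩

end

lemma exists_two_mul_C_eq_one : ∃ r : R2, (2 : Lam) * C r = 1 := by
  refine ⟨⟨2⁻¹, Subring.subset_closure rfl⟩, ?_⟩
  have h : (2 : R2) * ⟨2⁻¹, Subring.subset_closure rfl⟩ = 1 := by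
    apply Subtype.ext
    change (2 : ℚ) * 2⁻¹ = 1
    norm_num
  rw [← map_ofNat (C : R2 →+* Lam) 2, ← map_mul, h, map_one]

/-- The invariant λ₁² − λ₁λ₂ + λ₂², so that `cFour = 16 * eTwo`. -/
noncomputable def eTwo : Lam := X 0 ^ 2 - X 0 * X 1 + X 1 ^ 2

lemma eTwo_mem_invS {ρ : Equiv.Perm (Fin 3) →* (Lam ≃ₐ[R2] Lam)}
    (hσ₁ : ρ sig0 (X 0) = X 1 - X 0) (hσ₂ : ρ sig0 (X 1) = - X 0)
    (hτ₁ : ρ tau0 (X 0) = X 1) (hτ₂ : ρ tau0 (X 1) = X 0) :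
    eTwo ∈ invS ρ := by
  apply mem_invS_of_generators <;>
  simp only [eTwo, map_mul, map_add, map_sub, map_pow, hσ₁, hσ₂, hτ₁, hτ₂] <;> ring

lemma dE_sq_mem_invS {ρ : Equiv.Perm (Fin 3) →* (Lam ≃ₐ[R2] Lam)}
    (hσ₁ : ρ sig0 (X 0) = X 1 - X 0) (hσ₂ : ρ sig0 (X 1) = - X 0)
    (hτ₁ : ρ tau0 (X 0) = X 1) (hτ₂ : ρ tau0 (X 1) = X 0) :
    dE ^ 2 ∈ invS ρ := by
  apply mem_invS_of_generators <;>
  simp only [dE, map_mul, map_sub, map_pow, hσ₁, hσ₂, hτ₁, hτ₂] <;> ring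

lemma eTwo_mul_mem_normIdeal {ρ : Equiv.Perm (Fin 3) →* (Lam ≃ₐ[R2] Lam)} {v : Lam}
    (hv : v ∈ invS ρ) : eTwo * v ∈ normIdeal ρ := by
  obtain ⟨r, hr⟩ := exists_two_mul_C_eq_one
  have h : C r ∈ invS ρ := (invS ρ).algebraMap_mem r
  convert cFour_mul_mem_normIdeal (mul_mem (pow_mem h 4) hv) using 1
  have h16 : (16 : Lam) * C r ^ 4 = 1 := by
    calc (16 : Lam) * C r ^ 4 = (2 * C r) ^ 4 := by ring
      _ = 1 := by rw [hr, one_pow]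
  simp only [cFour, eTwo]
  linear_combination (-(X 0 ^ 2 - X 0 * X 1 + X 1 ^ 2) * v) * h16

lemma orbitSum_pow_mul_pow {ρ : Equiv.Perm (Fin 3) →* (Lam ≃ₐ[R2] Lam)}
    (hσ₁ : ρ sig0 (X 0) = X 1 - X 0) (hσ₂ : ρ sig0 (X 1) = - X 0)
    (hτ₁ : ρ tau0 (X 0) = X 1) (hτ₂ : ρ tau0 (X 1) = X 0) (i j : ℕ) :
    orbitSum ρ (X 0 ^ i * X 1 ^ j) =
      X 0 ^ i * X 1 ^ j + (X 1 - X 0) ^ i * (-X 0) ^ j + (-X 1) ^ i * (X 0 - X 1) ^ j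
        + (X 1 ^ i * X 0 ^ j + (X 0 - X 1) ^ i * (-X 1) ^ j + (-X 0) ^ i * (X 1 - X 0) ^ j) := by
  rw [orbitSum_eq]
  simp only [map_mul, map_sub, map_neg, map_pow, hσ₁, hσ₂, hτ₁, hτ₂]
  ring

lemma orbitSum_pow_mul_pow_mem_of_lt_six {ρ : Equiv.Perm (Fin 3) →* (Lam ≃ₐ[R2] Lam)}
    (hσ₁ : ρ sig0 (X 0) = X 1 - X 0) (hσ₂ : ρ sig0 (X 1) = - X 0)
    (hτ₁ : ρ tau0 (X 0) = X 1) (hτ₂ : ρ tau0 (X 1) = X 0) (j : ℕ)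
    (h : ∀ i < 6, orbitSum ρ (X 0 ^ i * X 1 ^ j) ∈ normIdeal ρ) (i : ℕ) :
    orbitSum ρ (X 0 ^ i * X 1 ^ j) ∈ normIdeal ρ := by
  have he := eTwo_mem_invS hσ₁ hσ₂ hτ₁ hτ₂
  have hd := dE_sq_mem_invS hσ₁ hσ₂ hτ₁ hτ₂
  induction i using Nat.strong_induction_on with
  | _ i ih =>
  by_cases hi : i < 6
  · exact h i hi
  · obtain ⟨k, rfl⟩ := Nat.exists_eq_add_of_le' (not_lt.1 hi)
    have hk : (X 0 ^ (k + 6) * X 1 ^ j : Lam) =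
        eTwo * (2 * X 0 ^ (k + 4) * X 1 ^ j - eTwo * (X 0 ^ (k + 2) * X 1 ^ j))
          + dE ^ 2 * (X 0 ^ k * X 1 ^ j) := by
      simp only [eTwo, dE]; ring
    rw [hk, map_add, orbitSum_mul he, orbitSum_mul hd]
    exact add_mem (eTwo_mul_mem_normIdeal (orbitSum_mem_invS _))
      (mul_mem_normIdeal hd (ih k (by omega)))

lemma orbitSum_pow_mul_pow_mem {ρ : Equiv.Perm (Fin 3) →* (Lam ≃ₐ[R2] Lam)}
    (hσ₁ : ρ sig0 (X 0) = X 1 - X 0) (hσ₂ : ρ sig0 (X 1) = - X 0)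
    (hτ₁ : ρ tau0 (X 0) = X 1) (hτ₂ : ρ tau0 (X 1) = X 0) (i j : ℕ) :
    orbitSum ρ (X 0 ^ i * X 1 ^ j) ∈ normIdeal ρ := by
  have he := eTwo_mem_invS hσ₁ hσ₂ hτ₁ hτ₂
  have hd := dE_sq_mem_invS hσ₁ hσ₂ hτ₁ hτ₂
  have hN := orbitSum_pow_mul_pow hσ₁ hσ₂ hτ₁ hτ₂
  have hE (f : Lam) : orbitSum ρ (eTwo * f) ∈ normIdeal ρ := by
    rw [orbitSum_mul he]
    exact eTwo_mul_mem_normIdeal (orbitSum_mem_invS f)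
  induction j using Nat.strong_induction_on generalizing i with
  | _ j ihj =>
  match j with
  | j + 2 =>
    have h : (X 0 ^ i * X 1 ^ (j + 2) : Lam) =
        X 0 ^ (i + 1) * X 1 ^ (j + 1) - X 0 ^ (i + 2) * X 1 ^ j
          + eTwo * (X 0 ^ i * X 1 ^ j) := by
      simp only [eTwo]; ring
    rw [h, map_add, map_sub]
    exact add_mem (sub_mem (ihj _ (by omega) _) (ihj _ (by omega) _)) (hE _)
  | 0 =>
    refine orbitSum_pow_mul_pow_mem_of_lt_six hσ₁ hσ₂ hτ₁ hτ₂ 0 (fun k hk => ?_) i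
    rw [hN]
    interval_cases k
    · convert three_mul_mem_normIdeal (ofNat_mem (invS ρ) 2) using 1; ring
    · convert zero_mem (normIdeal ρ) using 1; ring
    · convert eTwo_mul_mem_normIdeal (ofNat_mem (invS ρ) 4) using 1; simp only [eTwo]; ring
    · convert zero_mem (normIdeal ρ) using 1; ring
    · convert eTwo_mul_mem_normIdeal (mul_mem (ofNat_mem (invS ρ) 4) he) using 1
      simp only [eTwo]; ring
    · convert zero_mem (normIdeal ρ) using 1; ring
  | 1 =>
    have h32 : ∃ h ∈ invS ρ, (32 : Lam) * h = 1 := by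
      obtain ⟨r, hr⟩ := exists_two_mul_C_eq_one
      refine ⟨C r ^ 5, pow_mem ((invS ρ).algebraMap_mem r) 5, ?_⟩
      calc (32 : Lam) * C r ^ 5 = (2 * C r) ^ 5 := by ring
        _ = 1 := by rw [hr, one_pow]
    obtain ⟨h, hh, h32⟩ := h32
    refine orbitSum_pow_mul_pow_mem_of_lt_six hσ₁ hσ₂ hτ₁ hτ₂ 1 (fun k hk => ?_) i
    rw [hN]
    interval_cases k
    · convert zero_mem (normIdeal ρ) using 1; ring
    · convert eTwo_mul_mem_normIdeal (ofNat_mem (invS ρ) 2) using 1; simp only [eTwo]; ring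
    · convert cSix_mul_mem_normIdeal (neg_mem hh) using 1
      simp only [cSix]
      linear_combination
        ((X 0 + X 1) * (2 * X 0 ^ 2 - 5 * X 0 * X 1 + 2 * X 1 ^ 2)) * h32
    · convert eTwo_mul_mem_normIdeal (mul_mem (ofNat_mem (invS ρ) 2) he) using 1
      simp only [eTwo]; ring
    · convert cSix_mul_mem_normIdeal (mul_mem (neg_mem hh) he) using 1
      simp only [cSix, eTwo]
      linear_combination
        ((X 0 + X 1) * (2 * X 0 ^ 2 - 5 * X 0 * X 1 + 2 * X 1 ^ 2)
          * (X 0 ^ 2 - X 0 * X 1 + X 1 ^ 2)) * h32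
    · convert add_mem (three_mul_mem_normIdeal hd)
        (eTwo_mul_mem_normIdeal (mul_mem (ofNat_mem (invS ρ) 2) (pow_mem he 2))) using 1
      simp only [eTwo, dE]; ring

/-!
STATEMENT 9: The image of the norm map N : Λ → Λ, N(f) = Σ_{g ∈ S₃} g·f (whose
values lie in Λ^{S₃}) is exactly the ideal of the ring Λ^{S₃} generated by
3, c₄ and c₆, i.e. the set of elements 3u + c₄v + c₆w with u, v, w ∈ Λ^{S₃}.
-/

theorem statement9 (ρ : Equiv.Perm (Fin 3) →* (Lam ≃ₐ[R2] Lam))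
    (hσ₁ : ρ sig0 (X 0) = X 1 - X 0) (hσ₂ : ρ sig0 (X 1) = - X 0)
    (hτ₁ : ρ tau0 (X 0) = X 1) (hτ₂ : ρ tau0 (X 1) = X 0) :
    (∀ f : Lam, (∑ g : Equiv.Perm (Fin 3), ρ g f) ∈ invS ρ) ∧
    Set.range (fun f : Lam => ∑ g : Equiv.Perm (Fin 3), ρ g f) =
      {y : Lam | ∃ u ∈ invS ρ, ∃ v ∈ invS ρ, ∃ w ∈ invS ρ,
        y = 3 * u + cFour * v + cSix * w} := by
  have hmem (f : Lam) : orbitSum ρ f ∈ normIdeal ρ := by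
    induction f using MvPolynomial.induction_on' with
    | monomial u a =>
      rw [monomial_eq, Finsupp.prod_fintype _ _ (fun _ => pow_zero _), Fin.prod_univ_two,
        ← smul_eq_C_mul, map_smul]
      exact Submodule.smul_mem _ _ (orbitSum_pow_mul_pow_mem hσ₁ hσ₂ hτ₁ hτ₂ _ _)
    | add p q hp hq => rw [map_add]; exact add_mem hp hq
  simp only [← orbitSum_apply]
  refine ⟨orbitSum_mem_invS, Set.Subset.antisymm (Set.range_subset_iff.2 hmem) ?_⟩
  rintro _ ⟨u, hu, v, hv, w, hw, rfl⟩
  obtain ⟨r, hr⟩ := exists_two_mul_C_eq_one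
  have hN := orbitSum_pow_mul_pow hσ₁ hσ₂ hτ₁ hτ₂
  refine ⟨(C r * u) * (X 0 ^ 0 * X 1 ^ 0) + (4 * v) * (X 0 ^ 2 * X 1 ^ 0)
    + (-32 * w) * (X 0 ^ 2 * X 1 ^ 1), ?_⟩
  have h4 : (4 : Lam) ∈ invS ρ := ofNat_mem _ 4
  have h32 : (-32 : Lam) ∈ invS ρ := neg_mem (ofNat_mem _ 32)
  have hr' : C r ∈ invS ρ := (invS ρ).algebraMap_mem r
  simp only [map_add]
  rw [orbitSum_mul (mul_mem hr' hu), orbitSum_mul (mul_mem h4 hv),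
    orbitSum_mul (mul_mem h32 hw), hN, hN, hN]
  simp only [cFour, cSix]
  linear_combination 3 * u * hr
end

section
/- Let C = Λ_{S₃} be the module of coinvariants, i.e. the quotient of Λ by the ℤ[1/2]-submodule generated by all elements f − g·f (f ∈ Λ, g ∈ S₃), and let N̄ : C → Λ^{S₃} be the map induced by the norm N(f) = Σ_{g ∈ S₃} g·f. Then the kernel of N̄ equals the torsion submodule of C; it is annihilated by 3, and it is isomorphic as an abelian group to a countably infinite direct sum of copies of ℤ/3. -/
open MvPolynomial

set_option synthInstance.maxHeartbeats 1000000
set_option maxHeartbeats 4000000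

/-!
STATEMENT 12: Let C = Λ_{S₃} be the coinvariants, the quotient of Λ by the
ℤ[1/2]-submodule generated by all f − g·f, and N̄ : C → Λ^{S₃} ⊆ Λ the map induced
by the norm N(f) = Σ_{g ∈ S₃} g·f. Then ker N̄ equals the torsion submodule of C,
is annihilated by 3, and is isomorphic as an abelian group to a countably
infinite direct sum of copies of ℤ/3.
-/

/-- The submodule of Λ generated by the elements f − g·f. -/
noncomputable def coinvRel (ρ : Equiv.Perm (Fin 3) →* (Lam ≃ₐ[R2] Lam)) :
    Submodule R2 Lam :=
  Submodule.span R2 {x : Lam | ∃ (f : Lam) (g : Equiv.Perm (Fin 3)), x = f - ρ g f}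

/-- A countably infinite vector space over a finite field is a countable direct sum of copies of
the field. -/
theorem nonempty_linearEquiv_finsupp_nat {K V : Type*} [Field K] [Finite K] [AddCommGroup V]
    [Module K V] [Countable V] [Infinite V] : Nonempty (V ≃ₗ[K] (ℕ →₀ K)) := by
  let b := Module.Basis.ofVectorSpace K V
  have : Countable (Module.Basis.ofVectorSpaceIndex K V) := b.injective.countable
  have : Infinite (Module.Basis.ofVectorSpaceIndex K V) := by
    by_contra hfin
    have := not_infinite_iff_finite.mp hfin
    have := Module.Finite.of_basis b
    have := Module.finite_of_finite K (M := V)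
    exact not_finite V
  obtain ⟨_⟩ := nonempty_denumerable (Module.Basis.ofVectorSpaceIndex K V)
  exact ⟨b.repr.trans (Finsupp.domLCongr (Denumerable.eqv _))⟩

/-- A countably infinite abelian group of prime exponent `p` is a countable direct sum of copies
of `ZMod p`. -/
theorem nonempty_addEquiv_finsupp_zmod {A : Type*} [AddCommGroup A] [Countable A] [Infinite A]
    (p : ℕ) [Fact p.Prime] (h : ∀ a : A, p • a = 0) : Nonempty (A ≃+ (ℕ →₀ ZMod p)) := by
  let _ : Module (ZMod p) A := AddCommGroup.zmodModule h
  exact (nonempty_linearEquiv_finsupp_nat (K := ZMod p) (V := A)).map fun e => e.toAddEquiv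

theorem nonempty_ringHom_R2_zmod_three : Nonempty (R2 →+* ZMod 3) := by
  have hle : Subring.closure {(2⁻¹ : ℚ)} ≤
      (PadicInt.subring 3).comap (algebraMap ℚ ℚ_[3]) := by
    rw [Subring.closure_le, Set.singleton_subset_iff]
    have h2 : ‖((2 : ℤ) : ℚ_[3])‖ = 1 :=
      Padic.norm_intCast_eq_one_iff.mpr (by decide)
    simp only [Int.cast_ofNat] at h2
    change ‖algebraMap ℚ ℚ_[3] 2⁻¹‖ ≤ 1
    rw [map_inv₀, norm_inv, map_ofNat, h2, inv_one]
  exact ⟨(PadicInt.toZMod (p := 3)).comp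
    (((algebraMap ℚ ℚ_[3]).comp (Subring.subtype _)).codRestrict (PadicInt.subring 3)
      fun x => hle x.2)⟩

theorem perm_eq_pow_sig0_mul_pow_tau0 (g : Equiv.Perm (Fin 3)) :
    ∃ i j : Fin 3, g = sig0 ^ (i : ℕ) * tau0 ^ (j : ℕ) := by
  revert g
  decide

instance : Countable Lam :=
  (AddMonoidAlgebra.coeff_injective (R := R2) (M := Fin 2 →₀ ℕ)).countable

/-- The ring homomorphism `Λ → 𝔽₃[t]` extending `φ`, with `λ₁ ↦ u` and `λ₂ ↦ -u`. -/
noncomputable def evalAntidiag (φ : R2 →+* ZMod 3) (u : Polynomial (ZMod 3)) :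
    Lam →+* Polynomial (ZMod 3) :=
  eval₂Hom (Polynomial.C.comp φ) ![u, -u]

theorem three_eq_zero_polynomial_zmod : (3 : Polynomial (ZMod 3)) = 0 :=
  CharP.cast_eq_zero (Polynomial (ZMod 3)) 3

section

variable (φ : R2 →+* ZMod 3) (u : Polynomial (ZMod 3))

theorem evalAntidiag_C (r : R2) : evalAntidiag φ u (C r) = Polynomial.C (φ r) := by
  simp [evalAntidiag]

theorem evalAntidiag_X_zero : evalAntidiag φ u (X 0) = u := by
  simp [evalAntidiag]

theorem evalAntidiag_X_one : evalAntidiag φ u (X 1) = -u := by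
  simp [evalAntidiag]

theorem evalAntidiag_dE : evalAntidiag φ u dE = u ^ 3 := by
  simp only [dE, map_mul, map_sub, evalAntidiag_X_zero, evalAntidiag_X_one]
  linear_combination -u ^ 3 * three_eq_zero_polynomial_zmod

theorem evalAntidiag_X_zero_mul_dE_pow (k : ℕ) :
    evalAntidiag φ u (X 0 * dE ^ (2 * k + 1)) = u ^ (6 * k + 4) := by
  rw [map_mul, map_pow, evalAntidiag_dE, evalAntidiag_X_zero]
  ring

theorem evalAntidiag_algEquiv {α : Lam ≃ₐ[R2] Lam} {v : Polynomial (ZMod 3)}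
    (h₀ : evalAntidiag φ u (α (X 0)) = v) (h₁ : evalAntidiag φ u (α (X 1)) = -v) (f : Lam) :
    evalAntidiag φ u (α f) = evalAntidiag φ v f := by
  have : (evalAntidiag φ u).comp (α : Lam →+* Lam) = evalAntidiag φ v := by
    refine MvPolynomial.ringHom_ext (fun r => ?_) fun i => ?_
    · have : α (C r) = C r := α.commutes r
      simp [this, evalAntidiag_C]
    · fin_cases i
      · simpa [evalAntidiag_X_zero] using h₀
      · simpa [evalAntidiag_X_one] using h₁
  exact RingHom.congr_fun this f

end

section

variable {ρ : Equiv.Perm (Fin 3) →* (Lam ≃ₐ[R2] Lam)}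

theorem evalAntidiag_add_evalAntidiag_neg_rho
    (hσ₁ : ρ sig0 (X 0) = X 1 - X 0) (hσ₂ : ρ sig0 (X 1) = - X 0)
    (hτ₁ : ρ tau0 (X 0) = X 1) (hτ₂ : ρ tau0 (X 1) = X 0)
    (φ : R2 →+* ZMod 3) (u : Polynomial (ZMod 3)) (g : Equiv.Perm (Fin 3)) (f : Lam) :
    evalAntidiag φ u (ρ g f) + evalAntidiag φ (-u) (ρ g f) =
      evalAntidiag φ u f + evalAntidiag φ (-u) f := by
  have hσ (v : Polynomial (ZMod 3)) (f : Lam) :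
      evalAntidiag φ v (ρ sig0 f) = evalAntidiag φ v f := by
    apply evalAntidiag_algEquiv
    · rw [hσ₁, map_sub, evalAntidiag_X_zero, evalAntidiag_X_one]
      linear_combination -v * three_eq_zero_polynomial_zmod
    · rw [hσ₂, map_neg, evalAntidiag_X_zero]
  have hτ (v : Polynomial (ZMod 3)) (f : Lam) :
      evalAntidiag φ v (ρ tau0 f) = evalAntidiag φ (-v) f := by
    apply evalAntidiag_algEquiv
    · rw [hτ₁, evalAntidiag_X_one]
    · rw [hτ₂, evalAntidiag_X_zero, neg_neg]
  have hσpow (n : ℕ) (v : Polynomial (ZMod 3)) (f : Lam) :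
      evalAntidiag φ v (ρ (sig0 ^ n) f) = evalAntidiag φ v f := by
    induction n with
    | zero => simp
    | succ n ih => rw [pow_succ', map_mul, AlgEquiv.mul_apply, hσ, ih]
  obtain ⟨i, j, rfl⟩ := perm_eq_pow_sig0_mul_pow_tau0 g
  rw [map_mul, AlgEquiv.mul_apply, hσpow, hσpow]
  induction (j : ℕ) with
  | zero => simp
  | succ n ih =>
    rw [pow_succ', map_mul, AlgEquiv.mul_apply, hτ, hτ, neg_neg, add_comm, ih]

theorem evalAntidiag_add_evalAntidiag_neg_eq_zero
    (hσ₁ : ρ sig0 (X 0) = X 1 - X 0) (hσ₂ : ρ sig0 (X 1) = - X 0)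
    (hτ₁ : ρ tau0 (X 0) = X 1) (hτ₂ : ρ tau0 (X 1) = X 0)
    (φ : R2 →+* ZMod 3) (u : Polynomial (ZMod 3)) {x : Lam} (hx : x ∈ coinvRel ρ) :
    evalAntidiag φ u x + evalAntidiag φ (-u) x = 0 := by
  induction hx using Submodule.span_induction with
  | mem x hx =>
    obtain ⟨f, g, rfl⟩ := hx
    have := evalAntidiag_add_evalAntidiag_neg_rho hσ₁ hσ₂ hτ₁ hτ₂ φ u g f
    simp only [map_sub]
    linear_combination -this
  | zero => simp
  | add x y _ _ hx hy =>
    simp only [map_add]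
    linear_combination hx + hy
  | smul r x _ hx =>
    simp only [MvPolynomial.smul_eq_C_mul, map_mul, evalAntidiag_C]
    linear_combination Polynomial.C (φ r) * hx

theorem mk_X_zero_mul_dE_pow_injective
    (hσ₁ : ρ sig0 (X 0) = X 1 - X 0) (hσ₂ : ρ sig0 (X 1) = - X 0)
    (hτ₁ : ρ tau0 (X 0) = X 1) (hτ₂ : ρ tau0 (X 1) = X 0) :
    Function.Injective fun k : ℕ =>
      (Submodule.Quotient.mk (X 0 * dE ^ (2 * k + 1)) : Lam ⧸ coinvRel ρ) := by
  intro j k hjk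
  obtain ⟨φ⟩ := nonempty_ringHom_R2_zmod_three
  have h := evalAntidiag_add_evalAntidiag_neg_eq_zero hσ₁ hσ₂ hτ₁ hτ₂ φ Polynomial.X
    ((Submodule.Quotient.eq _).mp hjk)
  simp only [map_sub, evalAntidiag_X_zero_mul_dE_pow] at h
  rw [Even.neg_pow ⟨3 * j + 2, by ring⟩, Even.neg_pow ⟨3 * k + 2, by ring⟩] at h
  have hpow : (Polynomial.X : Polynomial (ZMod 3)) ^ (6 * j + 4) = Polynomial.X ^ (6 * k + 4) := by
    linear_combination -h + (Polynomial.X ^ (6 * j + 4) - Polynomial.X ^ (6 * k + 4)) *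
      three_eq_zero_polynomial_zmod
  have := congrArg Polynomial.natDegree hpow
  simp only [Polynomial.natDegree_X_pow] at this
  omega

theorem sum_rho_X_zero_mul_dE_pow
    (hσ₁ : ρ sig0 (X 0) = X 1 - X 0) (hσ₂ : ρ sig0 (X 1) = - X 0) (n : ℕ) :
    ∑ g : Equiv.Perm (Fin 3), ρ g (X 0 * dE ^ n) = 0 := by
  have hd : ρ sig0 dE = dE := by
    simp only [dE, map_mul, map_sub, hσ₁, hσ₂]
    ring
  have hshift (f : Lam) : ∑ g, ρ g (ρ sig0 f) = ∑ g, ρ g f := by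
    simpa using Equiv.sum_comp (Equiv.mulRight sig0) fun g => ρ g f
  have horbit : X 0 * dE ^ n + ρ sig0 (X 0 * dE ^ n) + ρ sig0 (ρ sig0 (X 0 * dE ^ n)) = 0 := by
    simp only [map_mul, map_pow, map_sub, hd, hσ₁, hσ₂]
    ring
  have hsum := congrArg (fun f => ∑ g, ρ g f) horbit
  simp only [map_add, map_zero, Finset.sum_add_distrib, Finset.sum_const_zero, hshift] at hsum
  have h3 : (3 : Lam) * ∑ g, ρ g (X 0 * dE ^ n) = 0 := by linear_combination hsum
  exact (mul_eq_zero.mp h3).resolve_left (by norm_num)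

theorem mk_rho (g : Equiv.Perm (Fin 3)) (f : Lam) :
    (Submodule.Quotient.mk (ρ g f) : Lam ⧸ coinvRel ρ) = Submodule.Quotient.mk f :=
  ((Submodule.Quotient.eq (coinvRel ρ)).mpr (Submodule.subset_span ⟨f, g, rfl⟩)).symm

variable (ρ) in
/-- The norm map from the coinvariants. -/
noncomputable def coinvNorm : (Lam ⧸ coinvRel ρ) →ₗ[R2] Lam :=
  (coinvRel ρ).liftQ (∑ g : Equiv.Perm (Fin 3), (ρ g).toLinearMap) <| by
    rw [coinvRel, Submodule.span_le]
    rintro _ ⟨f, g, rfl⟩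
    have : ∑ h, ρ h (ρ g f) = ∑ h, ρ h f := by
      simpa using Equiv.sum_comp (Equiv.mulRight g) fun h => ρ h f
    simp [this]

theorem coinvNorm_mk (f : Lam) :
    coinvNorm ρ (Submodule.Quotient.mk f) = ∑ g : Equiv.Perm (Fin 3), ρ g f := by
  simp [coinvNorm]

theorem three_smul_eq_zero_of_coinvNorm_eq_zero {x : Lam ⧸ coinvRel ρ}
    (hx : coinvNorm ρ x = 0) : (3 : R2) • x = 0 := by
  obtain ⟨f, rfl⟩ := Submodule.Quotient.mk_surjective _ x
  rw [coinvNorm_mk] at hx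
  have h : ∑ g : Equiv.Perm (Fin 3), (coinvRel ρ).mkQ (ρ g f) = 0 := by
    rw [← map_sum, hx, map_zero]
  simp only [Submodule.mkQ_apply, mk_rho, Finset.sum_const, Finset.card_univ,
    Fintype.card_perm, Fintype.card_fin] at h
  have h6 : (6 : R2) • (Submodule.Quotient.mk f : Lam ⧸ coinvRel ρ) = 0 := by
    rw [← h, ← Nat.cast_smul_eq_nsmul R2]
    norm_num [Nat.factorial]
  let half : R2 := ⟨2⁻¹, Subring.subset_closure rfl⟩
  have hhalf : half * 6 = 3 := Subtype.ext (by change (2⁻¹ : ℚ) * 6 = 3; norm_num)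
  rw [← hhalf, mul_smul, h6, smul_zero]

theorem ker_coinvNorm :
    LinearMap.ker (coinvNorm ρ) = Submodule.torsion R2 (Lam ⧸ coinvRel ρ) := by
  ext x
  rw [LinearMap.mem_ker, Submodule.mem_torsion_iff]
  constructor
  · exact fun hx => ⟨⟨3, mem_nonZeroDivisors_of_ne_zero (by norm_num)⟩,
      three_smul_eq_zero_of_coinvNorm_eq_zero hx⟩
  · rintro ⟨a, ha⟩
    have h : (a : R2) • coinvNorm ρ x = 0 := by
      rw [← map_smul]
      exact (congrArg _ ha).trans (map_zero _)
    exact (smul_eq_zero.mp h).resolve_left (nonZeroDivisors.coe_ne_zero a)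

end

theorem statement12 (ρ : Equiv.Perm (Fin 3) →* (Lam ≃ₐ[R2] Lam))
    (hσ₁ : ρ sig0 (X 0) = X 1 - X 0) (hσ₂ : ρ sig0 (X 1) = - X 0)
    (hτ₁ : ρ tau0 (X 0) = X 1) (hτ₂ : ρ tau0 (X 1) = X 0) :
    ∃ Nbar : (Lam ⧸ coinvRel ρ) →ₗ[R2] Lam,
      (∀ f : Lam, Nbar (Submodule.Quotient.mk f) = ∑ g : Equiv.Perm (Fin 3), ρ g f) ∧
      LinearMap.ker Nbar = Submodule.torsion R2 (Lam ⧸ coinvRel ρ) ∧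
      (∀ x ∈ LinearMap.ker Nbar, (3 : ℤ) • x = 0) ∧
      Nonempty ((LinearMap.ker Nbar) ≃+ (ℕ →₀ ZMod 3)) := by
  have h3 (x : Lam ⧸ coinvRel ρ) (hx : x ∈ LinearMap.ker (coinvNorm ρ)) : (3 : ℤ) • x = 0 := by
    rw [← Int.cast_smul_eq_zsmul R2]
    exact_mod_cast three_smul_eq_zero_of_coinvNorm_eq_zero hx
  refine ⟨coinvNorm ρ, coinvNorm_mk, ker_coinvNorm, h3, ?_⟩
  have : Countable (Lam ⧸ coinvRel ρ) := (Submodule.mkQ_surjective _).countable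
  have : Infinite (LinearMap.ker (coinvNorm ρ)) :=
    Infinite.of_injective (fun k : ℕ => ⟨Submodule.Quotient.mk (X 0 * dE ^ (2 * k + 1)),
      LinearMap.mem_ker.mpr ((coinvNorm_mk _).trans (sum_rho_X_zero_mul_dE_pow hσ₁ hσ₂ _))⟩)
      fun _ _ h => mk_X_zero_mul_dE_pow_injective hσ₁ hσ₂ hτ₁ hτ₂ (congrArg Subtype.val h)
  exact nonempty_addEquiv_finsupp_zmod 3 fun a =>
    Subtype.ext (by exact_mod_cast h3 a a.2)
end

section
/- For every s ≥ 1, the group cohomology H^s(S₃, Λ) (with Λ the S₃-representation over ℤ[1/2] described below) is annihilated by 3; moreover the endomorphisms of H^s(S₃, Λ) induced by the S₃-equivariant module maps ‘multiplication by c₄’ and ‘multiplication by c₆’ are zero. -/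
open MvPolynomial

set_option synthInstance.maxHeartbeats 1000000
set_option maxHeartbeats 4000000

/-!
STATEMENT 14: For every s ≥ 1, the group cohomology H^s(S₃, Λ) is annihilated
by 3, and the endomorphisms of H^s(S₃, Λ) induced by the S₃-equivariant module
maps "multiplication by c₄" and "multiplication by c₆" are zero.  The induced
endomorphism on cohomology is encoded by the map induced on homology by any
endomorphism of the complex of inhomogeneous cochains given in each degree by
postcomposition with multiplication by c₄ (resp. c₆).
-/

abbrev S3 := Equiv.Perm (Fin 3)

/-- The representation of S₃ on Λ underlying an action ρ by algebra automorphisms. -/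
noncomputable def toRep (ρ : S3 →* (Lam ≃ₐ[R2] Lam)) : Representation R2 S3 Lam where
  toFun g := (ρ g).toLinearMap
  map_one' := by ext f; simp
  map_mul' g h := by ext f; simp

open CategoryTheory in
/-- If a chain map is null-homotopic in degree `n + 1`, it is zero on the cohomology there. -/
theorem homologyMap_succ_eq_zero_of_eq_add {C : Type*} [Category C] [Preadditive C]
    [CategoryWithHomology C] {K L : CochainComplex C ℕ} (F : K ⟶ L) (n : ℕ)
    (h : K.X (n + 1) ⟶ L.X n) (h' : K.X (n + 2) ⟶ L.X (n + 1))
    (hF : F.f (n + 1) = h ≫ L.d n (n + 1) + K.d (n + 1) (n + 2) ≫ h') :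
    HomologicalComplex.homologyMap F (n + 1) = 0 := by
  have hcycles : HomologicalComplex.cyclesMap F (n + 1) =
      K.iCycles (n + 1) ≫ h ≫ L.toCycles n (n + 1) := by
    rw [← cancel_mono (L.iCycles (n + 1))]
    simp [hF]
  rw [← cancel_epi (K.homologyπ (n + 1)), HomologicalComplex.homologyπ_naturality, hcycles]
  simp

theorem Fin.contractNth_zero_cons {α : Type*} {n : ℕ} (op : α → α → α) (a : α)
    (v : Fin (n + 1) → α) :
    Fin.contractNth 0 op (Fin.cons a v : Fin (n + 2) → α) =
      Fin.cons (op a (v 0)) (fun i => v i.succ) := by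
  funext k
  cases k using Fin.cases <;> simp [Fin.contractNth]

theorem Fin.contractNth_succ_cons {α : Type*} {n : ℕ} (op : α → α → α) (a : α)
    (v : Fin (n + 1) → α) (j : Fin (n + 1)) :
    Fin.contractNth j.succ op (Fin.cons a v : Fin (n + 2) → α) =
      Fin.cons a (Fin.contractNth j op v) := by
  funext k
  cases k using Fin.cases <;> simp [Fin.contractNth]

section

open CategoryTheory

variable {k G : Type} [CommRing k] [Group G] [Fintype G] (A : Rep.{0} k G)

/-- The contracting operator `(h c)(v) = ∑ g, g⁻¹ φ(c(g, v))` on inhomogeneous cochains. -/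
noncomputable def traceHomotopy (φ : A →ₗ[k] A) (n : ℕ) :
    ModuleCat.of k ((Fin (n + 1) → G) → A) ⟶ ModuleCat.of k ((Fin n → G) → A) :=
  ModuleCat.ofHom
  { toFun c v := ∑ g : G, A.ρ g⁻¹ (φ (c (Fin.cons g v)))
    map_add' c c' := by
      ext v
      simp [Finset.sum_add_distrib]
    map_smul' r c := by
      ext v
      simp [Finset.smul_sum] }

/-- The trace of `φ` is homotopic to zero in positive degrees. -/
theorem traceHomotopy_d_add_d_traceHomotopy (φ : A →ₗ[k] A) (n : ℕ)
    (c : (Fin (n + 1) → G) → A) (v : Fin (n + 1) → G) :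
    (inhomogeneousCochains.d A n) ((traceHomotopy A φ n) c) v +
      (traceHomotopy A φ (n + 1)) ((inhomogeneousCochains.d A (n + 1)) c) v =
        ∑ g : G, A.ρ g⁻¹ (φ (A.ρ g (c v))) := by
  have hfirst : ∑ g : G, A.ρ g⁻¹ (φ (c (Fin.cons (g * v 0) fun i => v i.succ))) =
      A.ρ (v 0) (∑ g : G, A.ρ g⁻¹ (φ (c (Fin.cons g fun i => v i.succ)))) := by
    rw [map_sum, ← Equiv.sum_comp (Equiv.mulRight (v 0)) fun g => A.ρ (v 0) _]
    refine Finset.sum_congr rfl fun g _ => ?_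
    rw [← Module.End.mul_apply (A.ρ (v 0)), ← map_mul]
    simp
  simp only [inhomogeneousCochains.d_hom_apply, traceHomotopy, ModuleCat.hom_ofHom,
    LinearMap.coe_mk, AddHom.coe_mk]
  simp only [Fin.sum_univ_succ (n := n + 1), Fin.contractNth_zero_cons,
    Fin.contractNth_succ_cons, Fin.cons_zero, Fin.cons_succ, map_add, map_sum, map_smul,
    Finset.sum_add_distrib, Fin.val_zero, Fin.val_succ]
  rw [Finset.sum_comm]
  simp only [pow_succ _ (_ + 1), mul_neg, mul_one, neg_smul, Finset.sum_neg_distrib, Finset.smul_sum]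
  simp only [hfirst, map_sum, zero_add, pow_one, neg_smul, one_smul,
    Finset.sum_neg_distrib]
  abel

/-- A chain map given by the trace of a linear endomorphism vanishes on cohomology in positive
degrees. -/
theorem homologyMap_eq_zero_of_eq_trace (φ : A →ₗ[k] A)
    (F : groupCohomology.inhomogeneousCochains A ⟶ groupCohomology.inhomogeneousCochains A)
    (hF : ∀ (n : ℕ) (c : (Fin n → G) → A) (v : Fin n → G),
      (F.f n) c v = ∑ g : G, A.ρ g⁻¹ (φ (A.ρ g (c v))))
    (s : ℕ) (hs : 1 ≤ s) : HomologicalComplex.homologyMap F s = 0 := by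
  obtain ⟨n, rfl⟩ : ∃ n, s = n + 1 := ⟨s - 1, by omega⟩
  refine homologyMap_succ_eq_zero_of_eq_add F n (traceHomotopy A φ n)
    (traceHomotopy A φ (n + 1)) ?_
  rw [groupCohomology.inhomogeneousCochains.d_def, groupCohomology.inhomogeneousCochains.d_def]
  ext c v
  exact (hF _ c v).trans (traceHomotopy_d_add_d_traceHomotopy A φ n c v).symm

end

theorem sum_perm_three {M : Type*} [AddCommMonoid M] (f : S3 → M) :
    ∑ g, f g = f 1 + f sig0 + f (sig0 * sig0) + f tau0 + f (sig0 * tau0) +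
      f (sig0 * sig0 * tau0) := by
  have huniv : (Finset.univ : Finset S3) =
      {1, sig0, sig0 * sig0, tau0, sig0 * tau0, sig0 * sig0 * tau0} := by decide
  rw [huniv]
  repeat rw [Finset.sum_insert (by decide)]
  rw [Finset.sum_singleton]
  simp only [add_assoc]

/-- Multiplication by the trace of an element of `Λ` is the trace of a multiplication map. -/
theorem sum_toRep_mul (ρ : S3 →* (Lam ≃ₐ[R2] Lam)) (a m : Lam) :
    ∑ g, toRep ρ g⁻¹ (LinearMap.mulLeft R2 a (toRep ρ g m)) = (∑ g, ρ g a) * m := by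
  rw [← Equiv.sum_comp (Equiv.inv S3) (fun g => ρ g a), Finset.sum_mul]
  refine Finset.sum_congr rfl fun g _ => ?_
  change ρ g⁻¹ (a * ρ g m) = ρ g⁻¹ a * m
  rw [map_mul, ← AlgEquiv.mul_apply, ← map_mul]
  simp

/-- Multiplication by a trace vanishes on cohomology in positive degrees. -/
theorem homologyMap_eq_zero_of_eq_sum_mul (ρ : S3 →* (Lam ≃ₐ[R2] Lam)) (a b : Lam)
    (hab : ∑ g, ρ g a = b)
    (F : groupCohomology.inhomogeneousCochains (Rep.of (toRep ρ)) ⟶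
      groupCohomology.inhomogeneousCochains (Rep.of (toRep ρ)))
    (hF : ∀ (n : ℕ) (c : (Fin n → S3) → Lam) (v : Fin n → S3), (F.f n) c v = b * c v)
    (s : ℕ) (hs : 1 ≤ s) : HomologicalComplex.homologyMap F s = 0 :=
  homologyMap_eq_zero_of_eq_trace (Rep.of (toRep ρ)) (LinearMap.mulLeft R2 a) F
    (fun n c v => by
      rw [hF, ← hab]
      exact (sum_toRep_mul ρ a (c v)).symm) s hs

theorem six_nsmul_groupCohomology (ρ : S3 →* (Lam ≃ₐ[R2] Lam)) (s : ℕ) (hs : 1 ≤ s)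
    (x : groupCohomology (Rep.of (toRep ρ)) s) : (6 : ℕ) • x = 0 := by
  have hzero := homologyMap_eq_zero_of_eq_sum_mul ρ 1 6
    (by simp [Fintype.card_perm, Nat.factorial])
    ((6 : ℕ) • CategoryTheory.CategoryStruct.id _) (fun n c v => by
      change (6 : ℕ) • c v = 6 * c v
      simp) s hs
  have hmap := (HomologicalComplex.homologyFunctor (ModuleCat R2) (ComplexShape.up ℕ) s).map_nsmul
    (f := CategoryTheory.CategoryStruct.id
      (groupCohomology.inhomogeneousCochains (Rep.of (toRep ρ)))) (n := 6)
  rw [CategoryTheory.Functor.map_id] at hmap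
  have hid := hmap.symm.trans hzero
  exact congrArg (fun f => f.hom x) hid

theorem statement14 (ρ : S3 →* (Lam ≃ₐ[R2] Lam))
    (hσ₁ : ρ sig0 (X 0) = X 1 - X 0) (hσ₂ : ρ sig0 (X 1) = - X 0)
    (hτ₁ : ρ tau0 (X 0) = X 1) (hτ₂ : ρ tau0 (X 1) = X 0) :
    ∀ s : ℕ, 1 ≤ s →
      (∀ x : groupCohomology (Rep.of (toRep ρ)) s, (3 : ℤ) • x = 0) ∧
      (∀ F : groupCohomology.inhomogeneousCochains (Rep.of (toRep ρ)) ⟶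
             groupCohomology.inhomogeneousCochains (Rep.of (toRep ρ)),
        (∀ (n : ℕ) (c : (Fin n → S3) → Lam) (v : Fin n → S3),
          (F.f n) c v = cFour * c v) →
        HomologicalComplex.homologyMap F s = 0) ∧
      (∀ F : groupCohomology.inhomogeneousCochains (Rep.of (toRep ρ)) ⟶
             groupCohomology.inhomogeneousCochains (Rep.of (toRep ρ)),
        (∀ (n : ℕ) (c : (Fin n → S3) → Lam) (v : Fin n → S3),
          (F.f n) c v = cSix * c v) →
        HomologicalComplex.homologyMap F s = 0) := by
  intro s hs
  refine ⟨fun x => ?_, fun F hF => ?_, fun F hF => ?_⟩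
  · let half : R2 := ⟨2⁻¹, Subring.subset_closure rfl⟩
    have hhalf : half * 6 = 3 := Subtype.ext (by change (2⁻¹ : ℚ) * 6 = 3; norm_num)
    have hsix : (6 : R2) • x = 0 := by
      rw [← six_nsmul_groupCohomology ρ s hs x, ← Nat.cast_smul_eq_nsmul R2]
      rfl
    have hthree : (3 : R2) • x = 0 := by rw [← hhalf, mul_smul, hsix, smul_zero]
    rw [← hthree, ← Int.cast_smul_eq_zsmul R2]
    rfl
  · refine homologyMap_eq_zero_of_eq_sum_mul ρ (4 * X 0 ^ 2) _ ?_ F hF s hs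
    rw [sum_perm_three]
    simp only [map_mul, map_pow, map_sub, map_neg, map_one, map_ofNat, AlgEquiv.mul_apply,
      AlgEquiv.one_apply, hσ₁, hσ₂, hτ₁, cFour]
    ring
  · refine homologyMap_eq_zero_of_eq_sum_mul ρ (-32 * (X 0 ^ 2 * X 1)) _ ?_ F hF s hs
    rw [sum_perm_three]
    simp only [map_mul, map_pow, map_sub, map_neg, map_one, map_ofNat, AlgEquiv.mul_apply,
      AlgEquiv.one_apply, hσ₁, hσ₂, hτ₁, hτ₂, cSix]
    ring
end
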